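/- arXiv:1810.08657 — 5 statements merged into one kernel-verified Lean document; each statement's English description precedes it below -/
import Mathlib

section
/- Let n ≥ 5 and k ≥ 2 be integers with k ≤ n − 2 if n is even and k ≤ n − 3 if n is odd. Let G be a finite simple graph of order n with CR(G) = k and γ_CR(G) = r ≥ 3, and suppose G has a γ_CR-set S such that the subgraph of G induced by S has exactly b non-isolated vertices, where b ≤ k. If r ≤ n − r − (k − b), then |E(G)| ≤ C(b, 2) + (r − 2)(k − b) + C(n−r+1, 2) + ⌊(k − b)/2⌋; and if r > n − r − (k − b), then |E(G)| ≤ C(b, 2) + (r − 2)(k − b) + C(n−r+1, 2). -/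
open SimpleGraph Set

/-- The closed neighborhood `N[v]` of a vertex `v`. -/
def closedNbhd {V : Type*} (G : SimpleGraph V) (v : V) : Set V :=
  insert v (G.neighborSet v)

/-- `S` is a dominating set of `G`: every vertex lies in `N[s]` for some `s ∈ S`. -/
def IsDomSet {V : Type*} (G : SimpleGraph V) (S : Set V) : Prop :=
  ∀ v : V, ∃ s ∈ S, v ∈ closedNbhd G s

/-- `CR(S)`: the number of vertices overdominated by `S`, i.e. with `|N[x] ∩ S| ≥ 2`. -/
noncomputable def crOf {V : Type*} (G : SimpleGraph V) (S : Set V) : ℕ :=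
  {x : V | 2 ≤ (closedNbhd G x ∩ S).ncard}.ncard

/-- `CR(G)`: the minimum of `CR(S)` over all dominating sets `S` of `G`. -/
noncomputable def crNum {V : Type*} (G : SimpleGraph V) : ℕ :=
  sInf {k : ℕ | ∃ S : Set V, IsDomSet G S ∧ crOf G S = k}

/-- `γ_CR(G)`: the minimum cardinality of a dominating set `S` with `CR(S) = CR(G)`. -/
noncomputable def gammaCR {V : Type*} (G : SimpleGraph V) : ℕ :=
  sInf {r : ℕ | ∃ S : Set V, IsDomSet G S ∧ crOf G S = crNum G ∧ S.ncard = r}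

section GraphLemmas

variable {V : Type*} {G : SimpleGraph V}

theorem mem_closedNbhd_iff {v x : V} : x ∈ closedNbhd G v ↔ x = v ∨ G.Adj v x := by
  simp [closedNbhd]

theorem crNum_le {S : Set V} (hS : IsDomSet G S) : crNum G ≤ crOf G S :=
  Nat.sInf_le ⟨S, hS, rfl⟩

theorem gammaCR_le {S : Set V} (hS : IsDomSet G S) (hcr : crOf G S = crNum G) :
    gammaCR G ≤ S.ncard :=
  Nat.sInf_le ⟨S, hS, hcr, rfl⟩

/-- If the cardinality-redundance is positive, then no vertex is adjacent to all others. -/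
theorem exists_compl_adj (h : 0 < crNum G) (x : V) : ∃ y, Gᶜ.Adj x y := by
  by_contra! hx
  have hdom : IsDomSet G {x} := by
    intro v
    refine ⟨x, rfl, mem_closedNbhd_iff.2 ?_⟩
    have := hx v
    rw [compl_adj] at this
    grind
  have h0 : crOf G {x} = 0 := by
    have he : {y : V | 2 ≤ (closedNbhd G y ∩ {x}).ncard} = ∅ := by
      ext y
      have h1 : (closedNbhd G y ∩ {x}).ncard ≤ ({x} : Set V).ncard :=
        ncard_le_ncard inter_subset_right
      rw [ncard_singleton] at h1
      simp only [mem_ofPred_eq, mem_empty_iff_false, iff_false]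
      omega
    rw [crOf, he, ncard_empty]
  have := crNum_le hdom
  omega

/-- If `v` is the only non-neighbor of `u`, then every neighbor `w` of `v` has large degree,
because `{u, w}` is dominating and overdominates only vertices of `N[w] \ {v}`. -/
theorem crNum_add_two_le_ncard_closedNbhd [Finite V] (hg : 3 ≤ gammaCR G) {u v w : V}
    (huv : Gᶜ.Adj u v) (hu : ∀ y, Gᶜ.Adj u y → y = v) (hvw : G.Adj v w) :
    crNum G + 2 ≤ (closedNbhd G w).ncard := by
  have hdom : IsDomSet G {u, w} := by
    intro x
    by_cases hx : x = v
    · exact ⟨w, by simp, mem_closedNbhd_iff.2 (Or.inr (hx ▸ hvw.symm))⟩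
    · refine ⟨u, by simp, mem_closedNbhd_iff.2 ?_⟩
      have := mt (hu x) hx
      rw [compl_adj] at this
      grind
  have hpair : ({u, w} : Set V).ncard ≤ 2 := by
    have := ncard_insert_le u ({w} : Set V)
    rw [ncard_singleton] at this
    exact this
  have hne : crOf G {u, w} ≠ crNum G := fun h => by
    have := gammaCR_le hdom h
    omega
  have hle := crNum_le hdom
  have hsub : {x : V | 2 ≤ (closedNbhd G x ∩ {u, w}).ncard} ⊆ closedNbhd G w \ {v} := by
    intro x hx
    have heq : closedNbhd G x ∩ {u, w} = {u, w} :=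
      eq_of_subset_of_ncard_le inter_subset_right (hpair.trans hx)
    have hux : u ∈ closedNbhd G x := (heq.symm.subset (by simp : u ∈ ({u, w} : Set V))).1
    have hwx : w ∈ closedNbhd G x := (heq.symm.subset (by simp : w ∈ ({u, w} : Set V))).1
    rw [mem_closedNbhd_iff] at hux hwx
    refine ⟨mem_closedNbhd_iff.2 ?_, ?_⟩
    · rcases hwx with h | h
      · exact Or.inl h.symm
      · exact Or.inr h.symm
    · rintro rfl
      rw [compl_adj] at huv
      rcases hux with h | h
      · exact huv.1 h
      · exact huv.2 h.symm
  have h1 : crOf G {u, w} ≤ (closedNbhd G w \ {v}).ncard := ncard_le_ncard hsub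
  have h2 := ncard_sdiff_singleton_add_one (s := closedNbhd G w) (a := v)
    (mem_closedNbhd_iff.2 (Or.inr hvw.symm))
  omega

end GraphLemmas

section AdjCount

variable {V : Type*} {G : SimpleGraph V}

open Classical in
/-- The number of ordered pairs in `X × Y` that are adjacent in `G`, as an integer. -/
noncomputable def adjCount (G : SimpleGraph V) (X Y : Finset V) : ℤ :=
  ∑ x ∈ X, ∑ y ∈ Y, if G.Adj x y then 1 else 0

theorem adjCount_comm (X Y : Finset V) : adjCount G X Y = adjCount G Y X := by
  unfold adjCount
  rw [Finset.sum_comm]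
  refine Finset.sum_congr rfl fun x _ => Finset.sum_congr rfl fun y _ => ?_
  by_cases h : G.Adj x y <;> simp [h, G.adj_comm y x]

theorem adjCount_nonneg (X Y : Finset V) : 0 ≤ adjCount G X Y :=
  Finset.sum_nonneg fun _ _ => Finset.sum_nonneg fun _ _ => by split_ifs <;> simp

theorem adjCount_union_left [DecidableEq V] {X Y : Finset V} (h : Disjoint X Y) (Z : Finset V) :
    adjCount G (X ∪ Y) Z = adjCount G X Z + adjCount G Y Z :=
  Finset.sum_union h

theorem adjCount_union_right [DecidableEq V] {X Y : Finset V} (h : Disjoint X Y) (Z : Finset V) :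
    adjCount G Z (X ∪ Y) = adjCount G Z X + adjCount G Z Y := by
  rw [adjCount_comm, adjCount_union_left h, adjCount_comm X, adjCount_comm Y]

theorem adjCount_add_compl {X Y : Finset V} (h : Disjoint X Y) :
    adjCount G X Y + adjCount Gᶜ X Y = X.card * Y.card := by
  classical
  unfold adjCount
  rw [← Finset.sum_add_distrib]
  trans ∑ x ∈ X, (Y.card : ℤ)
  · refine Finset.sum_congr rfl fun x hx => ?_
    rw [← Finset.sum_add_distrib, Finset.card_eq_sum_ones, Nat.cast_sum]
    refine Finset.sum_congr rfl fun y hy => ?_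
    have hxy : x ≠ y := fun e => Finset.disjoint_left.1 h hx (e ▸ hy)
    by_cases ha : G.Adj x y <;> simp [compl_adj, ha, hxy]
  · simp

theorem adjCount_self_add_compl (X : Finset V) :
    adjCount G X X + adjCount Gᶜ X X = X.card * X.card - X.card := by
  classical
  unfold adjCount
  rw [← Finset.sum_add_distrib]
  trans ∑ x ∈ X, ((X.card : ℤ) - 1)
  · refine Finset.sum_congr rfl fun x hx => ?_
    have h1 : (X.card : ℤ) - 1 = ∑ y ∈ X, ((1 : ℤ) - if x = y then 1 else 0) := by
      rw [Finset.sum_sub_distrib]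
      simp [hx]
    rw [← Finset.sum_add_distrib, h1]
    refine Finset.sum_congr rfl fun y _ => ?_
    by_cases hxy : x = y
    · simp [hxy]
    · by_cases ha : G.Adj x y <;> simp [compl_adj, ha, hxy]
  · simp

theorem adjCount_self_le (X : Finset V) : adjCount G X X ≤ X.card * X.card - X.card := by
  have := adjCount_self_add_compl (G := G) X
  have := adjCount_nonneg (G := Gᶜ) X X
  omega

theorem adjCount_univ [Fintype V] :
    adjCount G Finset.univ Finset.univ = 2 * G.edgeSet.ncard := by
  classical
  have h := G.sum_degrees_eq_twice_card_edges
  have h2 : G.edgeSet.ncard = G.edgeFinset.card := by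
    rw [← coe_edgeFinset, ncard_coe_finset]
  rw [h2]
  unfold adjCount
  have : ∀ x, (∑ y, if G.Adj x y then (1 : ℤ) else 0) = (G.degree x : ℤ) := by
    intro x
    rw [← card_neighborFinset_eq_degree, neighborFinset_eq_filter]
    simp
  simp only [this]
  exact_mod_cast h

/-- The edge count split along a partition of the vertices into three parts. -/
theorem two_mul_ncard_edgeSet_eq [Fintype V] [DecidableEq V] {S P K : Finset V}
    (hSP : Disjoint S P) (hSK : Disjoint S K) (hPK : Disjoint P K)
    (hU : S ∪ P ∪ K = Finset.univ) :
    2 * (G.edgeSet.ncard : ℤ) = adjCount G S S + adjCount G P P + adjCount G K K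
      + 2 * adjCount G S P + 2 * adjCount G K S + 2 * adjCount G K P := by
  have hd : Disjoint (S ∪ P) K := Finset.disjoint_union_left.2 ⟨hSK, hPK⟩
  rw [← adjCount_univ, ← hU]
  simp only [adjCount_union_left hd, adjCount_union_right hd, adjCount_union_left hSP,
    adjCount_union_right hSP]
  rw [adjCount_comm P S, adjCount_comm S K, adjCount_comm P K]
  ring

/-- If every vertex of `K` has a neighbor, then the edges meeting `K` number at least `|K| / 2`. -/
theorem card_le_of_exists_adj [Fintype V] [DecidableEq V] {S P K : Finset V}
    (hU : S ∪ P ∪ K = Finset.univ) (h : ∀ x ∈ K, ∃ y, G.Adj x y) :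
    (K.card : ℤ) ≤ 2 * adjCount G K S + 2 * adjCount G K P + adjCount G K K := by
  classical
  unfold adjCount
  rw [Finset.mul_sum, Finset.mul_sum, ← Finset.sum_add_distrib, ← Finset.sum_add_distrib,
    Finset.card_eq_sum_ones, Nat.cast_sum]
  refine Finset.sum_le_sum fun x hx => ?_
  obtain ⟨y, hy⟩ := h x hx
  have hpos : ∀ X : Finset V, 0 ≤ ∑ y ∈ X, if G.Adj x y then (1 : ℤ) else 0 := fun X =>
    Finset.sum_nonneg fun _ _ => by split_ifs <;> simp
  have hone : ∀ X : Finset V, y ∈ X → 1 ≤ ∑ y ∈ X, if G.Adj x y then (1 : ℤ) else 0 := by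
    intro X hX
    have := Finset.single_le_sum (f := fun y => if G.Adj x y then (1 : ℤ) else 0)
      (fun _ _ => by split_ifs <;> simp) hX
    simpa [hy] using this
  have hyU : y ∈ S ∪ P ∪ K := hU ▸ Finset.mem_univ y
  have hS := hpos S
  have hP := hpos P
  have hK := hpos K
  rw [Finset.mem_union, Finset.mem_union] at hyU
  rcases hyU with (hy' | hy') | hy' <;> have := hone _ hy' <;> push_cast <;> omega

/-- If every vertex of `K` has a neighbor, and every leaf in `K` whose neighbor is in `K` has a
neighbor with some neighbor in `S`, then at least `|K|` edges meet `K`. -/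
theorem two_mul_card_le_of_exists_adj [Fintype V] [DecidableEq V] {S P K : Finset V}
    (hU : S ∪ P ∪ K = Finset.univ) (h : ∀ x ∈ K, ∃ y, G.Adj x y)
    (h2 : ∀ x ∈ K, ∀ y ∈ K, G.Adj x y → (∀ z, G.Adj x z → z = y) → ∃ s ∈ S, G.Adj y s) :
    2 * (K.card : ℤ) ≤ 2 * adjCount G K S + 2 * adjCount G K P + adjCount G K K := by
  classical
  set T : V → ℤ := fun x => if ∃ s ∈ S, G.Adj x s then 1 else 0 with hT
  have hT01 : ∀ x, T x = 0 ∨ T x = 1 := fun x => by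
    simp only [hT]; split_ifs <;> simp
  have hshift : adjCount G K K =
      ∑ x ∈ K, ∑ y ∈ K, (if G.Adj x y then (1 : ℤ) else 0) * (1 + T y - T x) := by
    have hsym : ∑ x ∈ K, ∑ y ∈ K, (if G.Adj x y then (1 : ℤ) else 0) * T y =
        ∑ x ∈ K, ∑ y ∈ K, (if G.Adj x y then (1 : ℤ) else 0) * T x := by
      rw [Finset.sum_comm]
      simp only [G.adj_comm]
    simp only [mul_sub, mul_add, Finset.sum_sub_distrib, Finset.sum_add_distrib, mul_one, hsym]
    simp [adjCount]
  rw [hshift]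
  unfold adjCount
  rw [Finset.mul_sum, Finset.mul_sum, ← Finset.sum_add_distrib, ← Finset.sum_add_distrib,
    Finset.card_eq_sum_ones, Nat.cast_sum, Finset.mul_sum]
  refine Finset.sum_le_sum fun x hx => ?_
  have hpos : ∀ X : Finset V, 0 ≤ ∑ y ∈ X, if G.Adj x y then (1 : ℤ) else 0 := fun X =>
    Finset.sum_nonneg fun _ _ => by split_ifs <;> simp
  have hone : ∀ X : Finset V, ∀ y ∈ X, G.Adj x y →
      1 ≤ ∑ y ∈ X, if G.Adj x y then (1 : ℤ) else 0 := by
    intro X y hX hy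
    have := Finset.single_le_sum (f := fun y => if G.Adj x y then (1 : ℤ) else 0)
      (fun _ _ => by split_ifs <;> simp) hX
    simpa [hy] using this
  have hKterm : ∀ y, 0 ≤ (if G.Adj x y then (1 : ℤ) else 0) * (1 + T y - T x) := by
    intro y
    refine mul_nonneg (by split_ifs <;> simp) ?_
    rcases hT01 x with h | h <;> rcases hT01 y with h' | h' <;> omega
  have hKpos : 0 ≤ ∑ y ∈ K, (if G.Adj x y then (1 : ℤ) else 0) * (1 + T y - T x) :=
    Finset.sum_nonneg fun y _ => hKterm y
  have hS := hpos S
  have hP := hpos P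
  push_cast
  by_cases hxS : ∃ s ∈ S, G.Adj x s
  · obtain ⟨s, hs, hxs⟩ := hxS
    have := hone S s hs hxs
    omega
  by_cases hxP : ∃ s ∈ P, G.Adj x s
  · obtain ⟨s, hs, hxs⟩ := hxP
    have := hone P s hs hxs
    omega
  have hTx : T x = 0 := by simp only [hT, if_neg hxS]
  have hnbr : ∀ y, G.Adj x y → y ∈ K := by
    intro y hy
    have hyU : y ∈ S ∪ P ∪ K := hU ▸ Finset.mem_univ y
    rw [Finset.mem_union, Finset.mem_union] at hyU
    rcases hyU with (hy' | hy') | hy'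
    · exact absurd ⟨y, hy', hy⟩ hxS
    · exact absurd ⟨y, hy', hy⟩ hxP
    · exact hy'
  obtain ⟨y, hy⟩ := h x hx
  suffices 2 ≤ ∑ y ∈ K, (if G.Adj x y then (1 : ℤ) else 0) * (1 + T y - T x) by omega
  by_cases hyT : ∃ s ∈ S, G.Adj y s
  · have hTy : T y = 1 := by simp only [hT, if_pos hyT]
    have := Finset.single_le_sum
      (f := fun y => (if G.Adj x y then (1 : ℤ) else 0) * (1 + T y - T x))
      (fun y _ => hKterm y) (hnbr y hy)
    simpa [hy, hTy, hTx] using this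
  · obtain ⟨z, hz, hzy⟩ : ∃ z, G.Adj x z ∧ z ≠ y := by
      by_contra! hc
      exact hyT (h2 x hx y (hnbr y hy) hy hc)
    have hsub : ({y, z} : Finset V) ⊆ K := by
      intro t ht
      rw [Finset.mem_insert, Finset.mem_singleton] at ht
      rcases ht with rfl | rfl
      · exact hnbr _ hy
      · exact hnbr _ hz
    have := Finset.sum_le_sum_of_subset_of_nonneg
      (f := fun y => (if G.Adj x y then (1 : ℤ) else 0) * (1 + T y - T x)) hsub
      (fun y _ _ => hKterm y)
    rw [Finset.sum_pair hzy.symm] at this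
    simp only [hy, hz, if_true, one_mul, hTx, sub_zero] at this ⊢
    rcases hT01 y with h | h <;> rcases hT01 z with h' | h' <;> omega

end AdjCount

section Redundance

variable {V : Type*} {G : SimpleGraph V}

theorem two_le_ncard_closedNbhd_inter_iff [Finite V] {S : Set V} {x : V} (hx : x ∈ S) :
    2 ≤ (closedNbhd G x ∩ S).ncard ↔ ∃ u ∈ S, G.Adj x u := by
  have hxm : x ∈ closedNbhd G x ∩ S := ⟨mem_closedNbhd_iff.2 (Or.inl rfl), hx⟩
  constructor
  · intro h
    obtain ⟨u, hu, hne⟩ := exists_ne_of_one_lt_ncard h x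
    exact ⟨u, hu.2, (mem_closedNbhd_iff.1 hu.1).resolve_left hne⟩
  · rintro ⟨u, hu, hxu⟩
    exact (one_lt_ncard_iff).2
      ⟨x, u, hxm, ⟨mem_closedNbhd_iff.2 (Or.inr hxu), hu⟩, hxu.ne⟩

theorem ncard_closedNbhd_inter_coe {S : Finset V} {x : V} (hx : x ∉ S) :
    ((closedNbhd G x ∩ S).ncard : ℤ) = adjCount G {x} S := by
  classical
  have : closedNbhd G x ∩ S = ((S.filter fun y => G.Adj x y : Finset V) : Set V) := by
    ext y
    simp only [mem_inter_iff, mem_closedNbhd_iff, Finset.mem_coe, Finset.coe_filter, mem_ofPred_eq]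
    constructor
    · rintro ⟨rfl | h, hy⟩
      · exact absurd hy hx
      · exact ⟨hy, h⟩
    · rintro ⟨hy, h⟩
      exact ⟨Or.inr h, hy⟩
  rw [this, ncard_coe_finset]
  simp [adjCount]

theorem one_le_ncard_closedNbhd_inter [Finite V] {S : Set V} (hS : IsDomSet G S) (x : V) :
    1 ≤ (closedNbhd G x ∩ S).ncard := by
  obtain ⟨s, hs, hx⟩ := hS x
  refine (ncard_pos).2 ⟨s, mem_closedNbhd_iff.2 ?_, hs⟩
  rcases mem_closedNbhd_iff.1 hx with h | h
  · exact Or.inl h.symm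
  · exact Or.inr h.symm

/-- If the vertices of `P` outside `S` are dominated exactly once by `S`, then there are `|P|`
edges between `S` and `P`. -/
theorem adjCount_eq_card {S P : Finset V}
    (hP : ∀ x ∈ P, x ∉ S ∧ (closedNbhd G x ∩ S).ncard = 1) : adjCount G S P = P.card := by
  rw [adjCount_comm, Finset.card_eq_sum_ones, Nat.cast_sum]
  refine Finset.sum_congr rfl fun x hx => ?_
  have h := ncard_closedNbhd_inter_coe (G := G) (hP x hx).1
  rw [(hP x hx).2] at h
  simpa [adjCount] using h.symm

/-- Only the non-isolated vertices of `S` contribute to the edges inside `S`. -/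
theorem adjCount_self_eq_of_subset {S B : Finset V} (hBS : B ⊆ S)
    (hB : ∀ x ∈ S, ∀ y ∈ S, G.Adj x y → x ∈ B) : adjCount G S S = adjCount G B B := by
  have h1 : adjCount G B S = adjCount G S S := by
    refine Finset.sum_subset hBS fun x hx hxB => Finset.sum_eq_zero fun y hy => ?_
    rw [if_neg fun h => hxB (hB x hx y hy h)]
  have h2 : adjCount G B B = adjCount G S B := by
    refine Finset.sum_subset hBS fun x hx hxB => Finset.sum_eq_zero fun y hy => ?_
    rw [if_neg fun h => hxB (hB x hx y (hBS hy) h)]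
  rw [h2, adjCount_comm S B, h1]

/-- A vertex `w` of `S` whose closed neighborhood has at least `|B| + |K| + 2` elements, where `B`
is the set of non-isolated vertices of `S`, has a neighbor in `P`. -/
theorem one_le_adjCount_singleton [Fintype V] [DecidableEq V] {S P K B : Finset V}
    (hU : S ∪ P ∪ K = Finset.univ) (hB : ∀ x ∈ S, ∀ y ∈ S, G.Adj x y → x ∈ B)
    {w : V} (hw : w ∈ S) (hN : B.card + K.card + 2 ≤ (closedNbhd G w).ncard) :
    1 ≤ adjCount G {w} P := by
  classical
  have hS : ∃ A : Finset V, A.card ≤ B.card + 1 ∧ ∀ y ∈ S, y = w ∨ G.Adj w y → y ∈ A := by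
    refine ⟨insert w B, Finset.card_insert_le _ _, fun y hy h => ?_⟩
    rcases h with rfl | h
    · simp
    · exact Finset.mem_insert_of_mem (hB y hy w hw h.symm)
  obtain ⟨A, hA, hAS⟩ := hS
  have hsub : closedNbhd G w ⊆ ((A ∪ K ∪ P.filter fun y => G.Adj w y : Finset V) : Set V) := by
    intro y hy
    rw [mem_closedNbhd_iff] at hy
    have hyU : y ∈ S ∪ P ∪ K := hU ▸ Finset.mem_univ y
    have := hAS y
    simp only [Finset.mem_union, Finset.mem_coe, Finset.mem_filter] at hyU ⊢
    rcases hyU with (h | h) | h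
    · exact Or.inl (Or.inl (this h hy))
    · rcases hy with rfl | hy
      · exact Or.inl (Or.inl (hAS y hw (Or.inl rfl)))
      · exact Or.inr ⟨h, hy⟩
    · exact Or.inl (Or.inr h)
  have h1 := ncard_le_ncard hsub (Finset.finite_toSet _)
  rw [ncard_coe_finset] at h1
  have h2 := Finset.card_union_le (A ∪ K) (P.filter fun y => G.Adj w y)
  have h3 := Finset.card_union_le A K
  have h4 : adjCount G {w} P = (P.filter fun y => G.Adj w y).card := by simp [adjCount]
  rw [h4]
  omega

end Redundance

theorem cast_choose_two_mul_two (m : ℕ) : 2 * (m.choose 2 : ℤ) = m * m - m := by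
  have h : (m.choose 2) * 2 = m * (m - 1) := by
    rw [Nat.choose_two_right, Nat.div_mul_cancel (Nat.even_mul_pred_self m).two_dvd]
  cases m with
  | zero => simp
  | succ m =>
    zify at h
    push_cast at h ⊢
    linarith

theorem edge_bound_of_gammaCRSet_nonisolated {V : Type*} [Fintype V]
    (G : SimpleGraph V) (n k r b : ℕ) (hcard : Fintype.card V = n)
    (hn : 5 ≤ n) (hk : 2 ≤ k)
    (hke : Even n → k ≤ n - 2) (hko : Odd n → k ≤ n - 3)
    (hcr : crNum G = k) (hr : 3 ≤ r) (hg : gammaCR G = r)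
    (S : Set V) (hdom : IsDomSet G S) (hcrS : crOf G S = crNum G)
    (hb : {v ∈ S | ∃ u ∈ S, G.Adj v u}.ncard = b) (hbk : b ≤ k) :
    (r ≤ n - r - (k - b) →
      G.edgeSet.ncard ≤
        b.choose 2 + (r - 2) * (k - b) + (n - r + 1).choose 2 + (k - b) / 2) ∧
    (n - r - (k - b) < r →
      G.edgeSet.ncard ≤
        b.choose 2 + (r - 2) * (k - b) + (n - r + 1).choose 2) := by
  classical
  obtain ⟨Sf, rfl⟩ : ∃ Sf : Finset V, S = Sf := ⟨S.toFinset, by simp⟩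
  set B : Finset V := Sf.filter fun v => ∃ u ∈ Sf, G.Adj v u with hBdef
  set K : Finset V := Finset.univ.filter
    fun x => x ∉ Sf ∧ 2 ≤ (closedNbhd G x ∩ Sf).ncard with hKdef
  set P : Finset V := Finset.univ.filter
    fun x => x ∉ Sf ∧ ¬ 2 ≤ (closedNbhd G x ∩ Sf).ncard with hPdef
  have hSP : Disjoint Sf P := Finset.disjoint_left.2 fun x hx hxP => by
    simp [hPdef, hx] at hxP
  have hSK : Disjoint Sf K := Finset.disjoint_left.2 fun x hx hxK => by
    simp [hKdef, hx] at hxK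
  have hPK : Disjoint P K := Finset.disjoint_left.2 fun x hxP hxK => by
    simp only [hPdef, hKdef, Finset.mem_filter] at hxP hxK
    exact hxP.2.2 hxK.2.2
  have hU : Sf ∪ P ∪ K = Finset.univ := by
    ext x
    simp only [hPdef, hKdef, Finset.mem_union, Finset.mem_filter, Finset.mem_univ, true_and,
      iff_true]
    tauto
  have hBS : B ⊆ Sf := Finset.filter_subset _ _
  have hB : ∀ x ∈ Sf, ∀ y ∈ Sf, G.Adj x y → x ∈ B := fun x hx y hy h =>
    Finset.mem_filter.2 ⟨hx, y, hy, h⟩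
  have hBcard : B.card = b := by
    rw [← hb, ← ncard_coe_finset]
    congr 1
    ext x
    simp [hBdef]
  have hBK : Disjoint B K := Finset.disjoint_of_subset_left hBS hSK
  have hKcard : B.card + K.card = k := by
    rw [← hcr, ← hcrS, ← Finset.card_union_of_disjoint hBK, ← ncard_coe_finset]
    unfold crOf
    congr 1
    ext x
    simp only [Finset.coe_union, mem_union, Finset.mem_coe, mem_ofPred_eq]
    by_cases hx : x ∈ Sf
    · rw [two_le_ncard_closedNbhd_inter_iff (Finset.mem_coe.2 hx)]
      simp [hBdef, hKdef, hx]
    · simp [hBdef, hKdef, hx]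
  have hP1 : ∀ x ∈ P, x ∉ Sf ∧ (closedNbhd G x ∩ Sf).ncard = 1 := fun x hx => by
    have h1 := one_le_ncard_closedNbhd_inter hdom x
    have h2 := (Finset.mem_filter.1 hx).2
    exact ⟨h2.1, by omega⟩
  have hn' : Sf.card + P.card + K.card = n := by
    rw [← Finset.card_union_of_disjoint hSP,
      ← Finset.card_union_of_disjoint (Finset.disjoint_union_left.2 ⟨hSK, hPK⟩), hU,
      Finset.card_univ, hcard]
  have hrs : r ≤ Sf.card := by
    have := gammaCR_le hdom hcrS
    rwa [hg, ncard_coe_finset] at this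
  have hmiss : ∀ x ∈ K, ∃ y, Gᶜ.Adj x y := fun x _ => exists_compl_adj (by omega) x
  have hgen := card_le_of_exists_adj hU hmiss
  have hspl := two_mul_ncard_edgeSet_eq (G := G) hSP hSK hPK hU
  have hSS := adjCount_self_eq_of_subset hBS hB
  have hBB := adjCount_self_le (G := G) B
  have hPP := adjCount_self_le (G := G) P
  have hKK := adjCount_self_add_compl (G := G) K
  have hSPc := adjCount_eq_card hP1
  have hKS := adjCount_add_compl (G := G) hSK.symm
  have hKP := adjCount_add_compl (G := G) hPK.symm
  have hcb := cast_choose_two_mul_two b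
  have hcn := cast_choose_two_mul_two (n - r + 1)
  have hkb : k - b = K.card := by omega
  rw [hkb]
  set D : ℤ := 2 * adjCount Gᶜ K Sf + 2 * adjCount Gᶜ K P + adjCount Gᶜ K K with hD
  have hmain : 2 * (G.edgeSet.ncard : ℤ) + D ≤
      2 * (b.choose 2 : ℤ) + 2 * (((r - 2) * K.card : ℕ) : ℤ) +
        2 * ((n - r + 1).choose 2 : ℤ) + 2 * K.card := by
    obtain ⟨t, ht⟩ := Nat.exists_eq_add_of_le hrs
    have hnr : ((n - r : ℕ) : ℤ) = t + P.card + K.card := by omega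
    have hr2 : ((r - 2 : ℕ) : ℤ) = Sf.card - t - 2 := by omega
    rw [hcb, hcn]
    push_cast
    rw [hnr, hr2, ← hBcard]
    have h0 : (0 : ℤ) ≤ t * P.card := by positivity
    have h1 : (0 : ℤ) ≤ t * t + t := by positivity
    linarith
  constructor
  · intro _
    omega
  · intro hlt
    have hstrong := two_mul_card_le_of_exists_adj hU hmiss (by
      intro u _ v hvmem huv hu
      by_contra! hv
      have hcount : (Sf.card : ℤ) ≤ adjCount G Sf P := by
        rw [Finset.card_eq_sum_ones, Nat.cast_sum]
        refine Finset.sum_le_sum fun w hw => ?_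
        have hvS : v ∉ Sf := fun h => Finset.disjoint_left.1 hSK h hvmem
        have hvw : G.Adj v w := by
          have := hv w hw
          rw [compl_adj] at this
          by_contra h
          exact this ⟨fun e => hvS (e ▸ hw), h⟩
        have hN := crNum_add_two_le_ncard_closedNbhd (by omega) huv hu hvw
        have := one_le_adjCount_singleton hU hB hw (by omega)
        simpa [adjCount] using this
      omega)
    omega
end

section
/- Let n ≥ 5 and k ≥ 0 be integers with k ≤ n − 2 if n is even and k ≤ n − 3 if n is odd. Then every finite simple graph G of order n with CR(G) = k and γ_CR(G) = r for some r ≥ 2 satisfies |E(G)| ≤ C(n−1, 2) + ⌊k/2⌋; that is, M(n,k,r) ≤ M(n,k,2) for all r ≥ 2. -/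
open SimpleGraph Set

theorem mem_closedNbhd_comm {V : Type*} (G : SimpleGraph V) (x y : V) :
    x ∈ closedNbhd G y ↔ y ∈ closedNbhd G x := by
  simp [closedNbhd, eq_comm, G.adj_comm]

theorem crOf_singleton {V : Type*} (G : SimpleGraph V) (v : V) : crOf G {v} = 0 := by
  have h : {x : V | 2 ≤ (closedNbhd G x ∩ {v}).ncard} = ∅ := by
    ext x
    have := Set.ncard_le_ncard (inter_subset_right (s := closedNbhd G x) (t := {v}))
    rw [Set.ncard_singleton] at this
    simp only [mem_ofPred_eq, mem_empty_iff_false, iff_false]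
    omega
  rw [crOf, h, Set.ncard_empty]

/-- A graph with a vertex adjacent to all others has `γ_CR ≤ 1`. -/
theorem gammaCR_le_one_of_isDomSet_singleton {V : Type*} (G : SimpleGraph V) {v : V}
    (h : IsDomSet G {v}) : gammaCR G ≤ 1 := by
  have h0 : crNum G = 0 :=
    Nat.le_zero.mp (Nat.sInf_le ⟨{v}, h, crOf_singleton G v⟩)
  exact Nat.sInf_le ⟨{v}, h, by rw [h0, crOf_singleton], Set.ncard_singleton v⟩

open Classical in
theorem degree_add_card_notMem_closedNbhd {V : Type*} [Fintype V] (G : SimpleGraph V) (x : V) :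
    G.degree x + (Finset.univ.filter fun y => y ∉ closedNbhd G x).card + 1 = Fintype.card V := by
  have h : (Finset.univ.filter fun y => y ∈ closedNbhd G x) = insert x (G.neighborFinset x) := by
    ext y
    simp [closedNbhd]
  have h' := Finset.card_filter_add_card_filter_not (s := (Finset.univ : Finset V))
    (fun y => y ∈ closedNbhd G x)
  rw [h, Finset.card_insert_of_notMem (by simp), G.card_neighborFinset_eq_degree,
    Finset.card_univ] at h'
  omega

open Classical in
/-- Each vertex that is not overdominated by `S` is missed by at least `|S| - 1` of the closed
neighborhoods of members of `S`. -/
theorem mul_le_sum_card_notMem_closedNbhd {V : Type*} [Fintype V] (G : SimpleGraph V)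
    (S : Finset V) :
    (Fintype.card V - crOf G S) * (S.card - 1) ≤
      ∑ s ∈ S, (Finset.univ.filter fun y => y ∉ closedNbhd G s).card := by
  set A : Finset V := Finset.univ.filter fun x => 2 ≤ (closedNbhd G x ∩ S).ncard with hA
  have hcr : crOf G S = A.card := by
    rw [crOf, ← Set.ncard_coe_finset]
    simp [hA]
  have hswap : ∑ s ∈ S, (Finset.univ.filter fun y => y ∉ closedNbhd G s).card =
      ∑ y, (S.filter fun s => y ∉ closedNbhd G s).card :=
    Finset.sum_card_bipartiteAbove_eq_sum_card_bipartiteBelow (fun s y => y ∉ closedNbhd G s)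
  rw [hswap, hcr, ← Finset.card_compl, ← smul_eq_mul]
  refine (Finset.card_nsmul_le_sum _ _ _ fun x hx => ?_).trans
    (Finset.sum_le_sum_of_subset (Finset.subset_univ Aᶜ))
  have hx' : (closedNbhd G x ∩ S).ncard < 2 := by simpa [hA] using hx
  have hset : closedNbhd G x ∩ S = ↑(S.filter fun s => x ∈ closedNbhd G s) := by
    ext y
    simp [mem_closedNbhd_comm G x y, and_comm]
  rw [hset, Set.ncard_coe_finset] at hx'
  have := Finset.card_filter_add_card_filter_not (s := S) (fun s => x ∈ closedNbhd G s)
  omega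

theorem M_n_k_r_le_M_n_k_two (n k : ℕ) (hn : 5 ≤ n)
    (hke : Even n → k ≤ n - 2) (hko : Odd n → k ≤ n - 3)
    {V : Type*} [Fintype V] (G : SimpleGraph V) (hcard : Fintype.card V = n)
    (r : ℕ) (hr : 2 ≤ r) (hcr : crNum G = k) (hg : gammaCR G = r) :
    G.edgeSet.ncard ≤ (n - 1).choose 2 + k / 2 := by
  classical
  have hk : k + 2 ≤ n := by
    rcases Nat.even_or_odd n with h | h
    · have := hke h; omega
    · have := hko h; omega
  obtain ⟨S, -, hScr, hSr⟩ : gammaCR G ∈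
      {r : ℕ | ∃ S : Set V, IsDomSet G S ∧ crOf G S = crNum G ∧ S.ncard = r} :=
    Nat.sInf_mem (Nat.nonempty_of_pos_sInf (by change 0 < gammaCR G; omega))
  lift S to Finset V using S.toFinite
  rw [Set.ncard_coe_finset, hg] at hSr
  rw [hcr] at hScr
  have hmissed (v : V) : 1 ≤ (Finset.univ.filter fun y => y ∉ closedNbhd G v).card := by
    by_contra! h
    have hdom : IsDomSet G {v} := fun x => ⟨v, rfl, by
      by_contra hx
      have hempty := Finset.card_eq_zero.mp (Nat.lt_one_iff.mp h)
      exact Finset.filter_eq_empty_iff.mp hempty (Finset.mem_univ x) hx⟩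
    have := gammaCR_le_one_of_isDomSet_singleton G hdom
    omega
  have hS := mul_le_sum_card_notMem_closedNbhd G S
  rw [hcard, hScr, hSr] at hS
  have hSc : n - r ≤ ∑ s ∈ Sᶜ, (Finset.univ.filter fun y => y ∉ closedNbhd G s).card := by
    have := Finset.card_nsmul_le_sum Sᶜ _ 1 fun v _ => hmissed v
    rwa [Finset.card_compl, hcard, hSr, smul_eq_mul, mul_one] at this
  have hsum := Finset.sum_add_sum_compl S
    fun s => (Finset.univ.filter fun y => y ∉ closedNbhd G s).card
  have hdeg := Finset.sum_congr (rfl : (Finset.univ : Finset V) = _)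
    fun x _ => degree_add_card_notMem_closedNbhd G x
  simp only [Finset.sum_add_distrib, Finset.sum_const, Finset.card_univ, hcard, smul_eq_mul,
    mul_one, G.sum_degrees_eq_twice_card_edges] at hdeg
  have hE : G.edgeSet.ncard = G.edgeFinset.card := by
    rw [← Set.ncard_coe_finset, G.coe_edgeFinset]
  have hrn : r ≤ n := hSr ▸ hcard ▸ S.card_le_univ
  have hchoose : (n - 1).choose 2 * 2 = (n - 1) * (n - 2) := by
    rw [Nat.choose_two_right, Nat.div_mul_cancel (Nat.even_mul_pred_self _).two_dvd]
    rfl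
  have hcount : 2 * n ≤ (n - k) * (r - 1) + (n - r) + k + 2 := by
    obtain ⟨a, rfl⟩ := Nat.exists_eq_add_of_le hr
    obtain ⟨b, rfl⟩ := Nat.exists_eq_add_of_le hk
    rw [show k + 2 + b - k = b + 2 by omega, show 2 + a - 1 = a + 1 by omega]
    have : (b + 2) * (a + 1) = a * b + b + 2 * a + 2 := by ring
    rw [this]
    have := Nat.zero_le (a * b)
    omega
  have hsq : n * n = (n - 1) * (n - 2) + 3 * n - 2 := by
    obtain ⟨c, rfl⟩ := Nat.exists_eq_add_of_le hn
    rw [show 5 + c - 1 = c + 4 by omega, show 5 + c - 2 = c + 3 by omega]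
    have h1 : (5 + c) * (5 + c) = c * c + 10 * c + 25 := by ring
    have h2 : (c + 4) * (c + 3) = c * c + 7 * c + 12 := by ring
    omega
  omega
end

section
/- Let G be a finite simple graph of order n ≥ 5 with CR(G) = 2. Then γ_CR(G) ≤ n − 2. -/
open SimpleGraph Set

theorem mem_closedNbhd {V : Type*} {G : SimpleGraph V} {v w : V} :
    w ∈ closedNbhd G v ↔ w = v ∨ G.Adj v w := by
  simp [closedNbhd]

theorem two_le_ncard_closedNbhd_inter {V : Type*} [Finite V] {G : SimpleGraph V} {S : Set V}
    {a b : V} (ha : a ∈ S) (hb : b ∈ S) (hab : G.Adj a b) :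
    2 ≤ (closedNbhd G a ∩ S).ncard :=
  (Set.one_lt_ncard (Set.toFinite _)).2
    ⟨a, ⟨mem_closedNbhd.2 (Or.inl rfl), ha⟩, b, ⟨mem_closedNbhd.2 (Or.inr hab), hb⟩, hab.ne⟩

/-- Deleting an end of an edge inside `S` lowers the cardinality-redundance of `S`, and keeps `S`
dominating as long as the vertices outside `S` stay dominated. -/
theorem crNum_lt_two_of_adj {V : Type*} [Finite V] {G : SimpleGraph V} {S : Set V} {x y : V}
    (hS : crOf G S = 2) (hx : x ∈ S) (hy : y ∈ S) (hxy : G.Adj x y)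
    (hout : ∀ v ∉ S, ∃ s ∈ S \ {y}, v ∈ closedNbhd G s) : crNum G < 2 := by
  have hxO : x ∈ {x : V | 2 ≤ (closedNbhd G x ∩ S).ncard} :=
    two_le_ncard_closedNbhd_inter hx hy hxy
  have hyO : y ∈ {x : V | 2 ≤ (closedNbhd G x ∩ S).ncard} :=
    two_le_ncard_closedNbhd_inter hy hx hxy.symm
  have hO : {x, y} = {x : V | 2 ≤ (closedNbhd G x ∩ S).ncard} := by
    refine Set.eq_of_subset_of_ncard_le (Set.insert_subset hxO (by simpa using hyO)) ?_
    rw [Set.ncard_pair hxy.ne]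
    exact hS.le
  have hdom : IsDomSet G (S \ {y}) := by
    intro v
    by_cases hv : v ∈ S
    · by_cases hvy : v = y
      · exact ⟨x, ⟨hx, hxy.ne⟩, mem_closedNbhd.2 (Or.inr (hvy ▸ hxy))⟩
      · exact ⟨v, ⟨hv, hvy⟩, mem_closedNbhd.2 (Or.inl rfl)⟩
    · exact hout v hv
  have hsub : {z : V | 2 ≤ (closedNbhd G z ∩ (S \ {y})).ncard} ⊆ {x} := by
    intro z hz
    have hzO : z ∈ ({x, y} : Set V) := by
      rw [hO]
      exact le_trans hz (Set.ncard_le_ncard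
        (Set.inter_subset_inter_right _ Set.sdiff_subset) (Set.toFinite _))
    rcases hzO with rfl | rfl
    · rfl
    · exfalso
      have key : ∀ w ∈ closedNbhd G z ∩ (S \ {z}), w = x := by
        rintro w ⟨hw, hwS, hwz⟩
        have hadj : G.Adj z w := (mem_closedNbhd.1 hw).resolve_left hwz
        have hwO : w ∈ ({x, z} : Set V) := by
          rw [hO]
          exact two_le_ncard_closedNbhd_inter hwS hy hadj.symm
        exact hwO.resolve_right hwz
      obtain ⟨a, ha, b, hb, hab⟩ := (Set.one_lt_ncard (Set.toFinite _)).1 hz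
      exact hab ((key a ha).trans (key b hb).symm)
  calc crNum G ≤ crOf G (S \ {y}) := Nat.sInf_le ⟨_, hdom, rfl⟩
    _ ≤ ({x} : Set V).ncard := Set.ncard_le_ncard hsub (Set.toFinite _)
    _ < 2 := by simp

theorem gammaCR_le_of_crNum_eq_two {V : Type*} [Fintype V] (G : SimpleGraph V)
    (hn : 5 ≤ Fintype.card V) (h : crNum G = 2) :
    gammaCR G ≤ Fintype.card V - 2 := by
  have hne : {k : ℕ | ∃ S : Set V, IsDomSet G S ∧ crOf G S = k}.Nonempty :=
    ⟨_, Set.univ, fun v => ⟨v, trivial, mem_closedNbhd.2 (Or.inl rfl)⟩, rfl⟩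
  obtain ⟨S, hdom, hS⟩ : ∃ S : Set V, IsDomSet G S ∧ crOf G S = crNum G := Nat.sInf_mem hne
  refine (Nat.sInf_le ⟨S, hdom, hS, rfl⟩ : gammaCR G ≤ S.ncard).trans ?_
  rw [h] at hS
  by_contra! hcard
  have hcompl : Sᶜ.ncard ≤ 1 := by
    have := Set.ncard_add_ncard_compl S
    rw [Nat.card_eq_fintype_card] at this
    omega
  obtain ⟨x, hxO, hx⟩ : ∃ x ∈ {x : V | 2 ≤ (closedNbhd G x ∩ S).ncard}, x ∈ S := by
    by_contra! hne
    have : crOf G S ≤ Sᶜ.ncard := Set.ncard_le_ncard hne (Set.toFinite _)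
    omega
  obtain ⟨y, ⟨hyN, hy⟩, hyx⟩ := Set.exists_ne_of_one_lt_ncard hxO x
  have hxy : G.Adj x y := (mem_closedNbhd.1 hyN).resolve_left hyx
  by_cases hout : ∀ v ∉ S, ∃ s ∈ S \ {y}, v ∈ closedNbhd G s
  · exact (crNum_lt_two_of_adj hS hx hy hxy hout).ne h
  · push Not at hout
    obtain ⟨v, hv, hvy⟩ := hout
    refine (crNum_lt_two_of_adj hS hy hx hxy.symm fun w hw => ?_).ne h
    obtain rfl : w = v := (Set.ncard_le_one (Set.toFinite _)).1 hcompl w hw v hv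
    obtain ⟨s, hs, hws⟩ := hdom w
    obtain rfl : s = y := by
      by_contra hsy
      exact hvy s ⟨hs, hsy⟩ hws
    exact ⟨s, ⟨hs, hyx⟩, hws⟩
end

section
/- Let G be a finite simple graph of order n ≥ 4. Then CR(G) = 2 and γ_CR(G) = n − 2 if and only if G is isomorphic to the disjoint union of a cycle on four vertices and n − 4 isolated vertices. -/
open SimpleGraph Set

/-- The graph on `Fin n` consisting of a cycle on the four vertices `0,1,2,3`
(edges `0-1`, `1-2`, `2-3`, `3-0`) together with `n - 4` isolated vertices. -/
def c4UnionIsolated (n : ℕ) : SimpleGraph (Fin n) :=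
  SimpleGraph.fromRel (fun i j => i.val < 4 ∧ j.val < 4 ∧ (i.val + 1) % 4 = j.val)

/-- `x` is overdominated by `S`. -/
def IsOverdominated {V : Type*} (G : SimpleGraph V) (S : Set V) (x : V) : Prop :=
  ∃ y ∈ S, ∃ z ∈ S, y ≠ z ∧ (x = y ∨ G.Adj x y) ∧ (x = z ∨ G.Adj x z)

/-- The edges of `G` are exactly those of the four-cycle `p q r s`. -/
def IsFourCycle {V : Type*} (G : SimpleGraph V) (p q r s : V) : Prop :=
  (p ≠ q ∧ p ≠ r ∧ p ≠ s ∧ q ≠ r ∧ q ≠ s ∧ r ≠ s) ∧ ∀ x y, G.Adj x y ↔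
    (x = p ∧ y = q) ∨ (x = q ∧ y = p) ∨ (x = q ∧ y = r) ∨ (x = r ∧ y = q) ∨
    (x = r ∧ y = s) ∨ (x = s ∧ y = r) ∨ (x = s ∧ y = p) ∨ (x = p ∧ y = s)

section

variable {V : Type*} {G : SimpleGraph V}

lemma isDomSet_iff {S : Set V} : IsDomSet G S ↔ ∀ v, ∃ s ∈ S, v = s ∨ G.Adj v s := by
  simp only [IsDomSet, closedNbhd, Set.mem_insert_iff, mem_neighborSet, G.adj_comm]

variable [Finite V]

lemma crOf_eq_ncard (S : Set V) : crOf G S = {x | IsOverdominated G S x}.ncard := by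
  unfold crOf
  congr 1
  ext x
  refine (Set.one_lt_ncard_iff (Set.toFinite _)).trans ?_
  simp only [Set.mem_ofPred_eq, IsOverdominated, closedNbhd, Set.mem_inter_iff,
    Set.mem_insert_iff, mem_neighborSet]
  constructor
  · rintro ⟨y, z, ⟨hy, hyS⟩, ⟨hz, hzS⟩, hyz⟩
    exact ⟨y, hyS, z, hzS, hyz, hy.imp_left Eq.symm, hz.imp_left Eq.symm⟩
  · rintro ⟨y, hyS, z, hzS, hyz, hy, hz⟩
    exact ⟨y, z, ⟨hy.imp_left Eq.symm, hyS⟩, ⟨hz.imp_left Eq.symm, hzS⟩, hyz⟩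

lemma two_le_crOf_iff {S : Set V} :
    2 ≤ crOf G S ↔ ∃ x y, IsOverdominated G S x ∧ IsOverdominated G S y ∧ x ≠ y := by
  rw [crOf_eq_ncard]
  exact Set.one_lt_ncard_iff (Set.toFinite _)

lemma crOf_le_two {S : Set V} {x y : V}
    (h : ∀ z, IsOverdominated G S z → z = x ∨ z = y) : crOf G S ≤ 2 := by
  rw [crOf_eq_ncard]
  exact (Set.ncard_le_ncard (t := {x, y}) (fun z hz => h z hz) (Set.toFinite _)).trans
    (Set.ncard_insert_le x {y} |>.trans (by simp))

/-- A set of `n - 2` vertices with an internal edge as a minimum-redundance dominating set forces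
a four-cycle through that edge. -/
lemma exists_isFourCycle_of_adj
    (hmin : ∀ T : Set V, IsDomSet G T → 2 ≤ crOf G T)
    {S : Set V} {a b u v : V} (hab : a ≠ b) (hS : ∀ x, x ∈ S ↔ x ≠ a ∧ x ≠ b)
    (hdom : IsDomSet G S) (hu : u ∈ S) (hv : v ∈ S) (huv : G.Adj u v)
    (hover : ∀ x, IsOverdominated G S x → x = u ∨ x = v) :
    ∃ p q r s, IsFourCycle G p q r s := by
  classical
  have huv' : u ≠ v := huv.ne
  have unique : ∀ x y z, y ∈ S → z ∈ S → (x = y ∨ G.Adj x y) → (x = z ∨ G.Adj x z) →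
      x ≠ u → x ≠ v → y = z := by
    intro x y z hy hz hxy hxz hxu hxv
    by_contra hyz
    rcases hover x ⟨y, hy, z, hz, hyz, hxy, hxz⟩ with h | h <;> contradiction
  rw [isDomSet_iff] at hdom
  have indep : ∀ x ∈ S, ∀ y ∈ S, G.Adj x y → (x = u ∧ y = v) ∨ (x = v ∧ y = u) := by
    intro x hx y hy h
    have h1 := hover x ⟨x, hx, y, hy, h.ne, Or.inl rfl, Or.inr h⟩
    have h2 := hover y ⟨x, hx, y, hy, h.ne, Or.inr h.symm, Or.inl rfl⟩
    have := h.ne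
    grind
  have haS : a ∉ S := by simp [hS]
  have hbS : b ∉ S := by simp [hS]
  obtain ⟨s, hs, has⟩ := hdom a
  obtain ⟨t, ht, hbt⟩ := hdom b
  replace has : G.Adj a s := has.resolve_left (by rintro rfl; contradiction)
  replace hbt : G.Adj b t := hbt.resolve_left (by rintro rfl; contradiction)
  have has' : ∀ y ∈ S, G.Adj a y → y = s := fun y hy h =>
    unique a y s hy hs (Or.inr h) (Or.inr has) (by grind) (by grind)
  have hbt' : ∀ y ∈ S, G.Adj b y → y = t := fun y hy h =>
    unique b y t hy ht (Or.inr h) (Or.inr hbt) (by grind) (by grind)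
  -- Every endpoint of the internal edge is needed to dominate `a` or `b`.
  have endpoint : ∀ w w', w ∈ S → w' ∈ S → G.Adj w w' → w = s ∨ w = t := by
    intro w w' hw hw' hww
    by_contra! hne
    have hww' := hww.ne
    obtain ⟨x, -, ⟨y, hy, z, hz, hyz, hxy, hxz⟩, -⟩ := two_le_crOf_iff.1 (hmin (S \ {w}) (by
      rw [isDomSet_iff]
      intro x
      by_cases hxw : x = w
      · exact ⟨w', ⟨hw', hww'.symm⟩, Or.inr (hxw ▸ hww)⟩
      by_cases hxa : x = a
      · exact ⟨s, ⟨hs, hne.1.symm⟩, Or.inr (hxa ▸ has)⟩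
      by_cases hxb : x = b
      · exact ⟨t, ⟨ht, hne.2.symm⟩, Or.inr (hxb ▸ hbt)⟩
      · exact ⟨x, ⟨(hS x).2 ⟨hxa, hxb⟩, hxw⟩, Or.inl rfl⟩))
    obtain ⟨hyS, hyw⟩ := hy
    obtain ⟨hzS, hzw⟩ := hz
    simp only [Set.mem_singleton_iff] at hyw hzw
    have := indep w hw w' hw' hww
    have := hover x ⟨y, hyS, z, hzS, hyz, hxy, hxz⟩
    have hxS : x ∈ S := by grind
    have := indep x hxS y hyS
    have := indep x hxS z hzS
    grind
  have hst : (s = u ∧ t = v) ∨ (s = v ∧ t = u) := by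
    have := endpoint u v hu hv huv
    have := endpoint v u hv hu huv.symm
    grind
  have hadj : G.Adj a b := by
    by_contra hnab
    have hnba : ¬ G.Adj b a := fun h => hnab h.symm
    obtain ⟨x, -, ⟨y, hy, z, hz, hyz, hxy, hxz⟩, -⟩ :=
      two_le_crOf_iff.1 (hmin {x | x ≠ u ∧ x ≠ v} (by
      rw [isDomSet_iff]
      intro x
      by_cases hxs : x = s
      · exact ⟨a, by simp only [Set.mem_ofPred_eq]; grind, Or.inr (hxs ▸ has.symm)⟩
      by_cases hxt : x = t
      · exact ⟨b, by simp only [Set.mem_ofPred_eq]; grind, Or.inr (hxt ▸ hbt.symm)⟩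
      · exact ⟨x, by simp only [Set.mem_ofPred_eq]; grind, Or.inl rfl⟩))
    have key : ∀ w, w ≠ u ∧ w ≠ v → (x = w ∨ G.Adj x w) →
        w = if x = s then a else if x = t then b else x := by
      intro w hw hxw
      have := has' w
      have := hbt' w
      have := has' x
      have := hbt' x
      have := indep x
      have := G.adj_comm x w
      grind
    exact hyz ((key y hy hxy).trans (key z hz hxz).symm)
  refine ⟨a, s, t, b, by grind, fun x y => ?_⟩
  have hts : G.Adj s t := by
    rcases hst with ⟨rfl, rfl⟩ | ⟨rfl, rfl⟩
    exacts [huv, huv.symm]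
  constructor
  · intro h
    have := has' y
    have := hbt' y
    have := has' x
    have := hbt' x
    have := indep x
    have := h.symm
    have := h.ne
    clear has' hbt' indep unique endpoint hover hmin hdom
    grind
  · rintro (⟨rfl, rfl⟩ | ⟨rfl, rfl⟩ | ⟨rfl, rfl⟩ | ⟨rfl, rfl⟩ | ⟨rfl, rfl⟩ | ⟨rfl, rfl⟩ |
      ⟨rfl, rfl⟩ | ⟨rfl, rfl⟩)
    exacts [has, has.symm, hts, hts.symm, hbt.symm, hbt, hadj.symm, hadj]

/-- An independent set of `n - 2` vertices overdominating its two missing vertices `a` and `b`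
contains the whole neighborhood of `b` in that of `a`. -/
lemma not_adj_and_adj_of_adj
    (hmin : ∀ T : Set V, IsDomSet G T → 2 ≤ crOf G T)
    {S : Set V} {a b : V} (hab : a ≠ b) (hS : ∀ x, x ∈ S ↔ x ≠ a ∧ x ≠ b)
    (hindep : ∀ x ∈ S, ∀ y ∈ S, ¬ G.Adj x y) :
    ¬ G.Adj a b ∧ ∀ x ∈ S, G.Adj b x → G.Adj a x := by
  by_contra hcon
  have hb : G.Adj a b ∨ ∃ x ∈ S, G.Adj b x ∧ ¬ G.Adj a x := by
    by_contra! h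
    exact hcon ⟨h.1, h.2⟩
  obtain ⟨x, x', hx, hx', hne⟩ := two_le_crOf_iff.1 (hmin {x | x ≠ b ∧ ¬ G.Adj a x} (by
    rw [isDomSet_iff]
    intro x
    by_cases hax : G.Adj a x
    · exact ⟨a, ⟨hab, G.loopless.irrefl a⟩, Or.inr hax.symm⟩
    by_cases hxb : x = b
    · subst hxb
      obtain ⟨y, hy, hby, hay⟩ := hb.resolve_left hax
      exact ⟨y, ⟨hby.ne', hay⟩, Or.inr hby⟩
    · exact ⟨x, ⟨hxb, hax⟩, Or.inl rfl⟩))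
  have key : ∀ x, IsOverdominated G {x | x ≠ b ∧ ¬ G.Adj a x} x → x = b := by
    rintro x ⟨y, ⟨hyb, hay⟩, z, ⟨hzb, haz⟩, hyz, hxy, hxz⟩
    have := hindep x
    have := G.adj_comm x a
    grind
  exact hne ((key x hx).trans (key x' hx').symm)

lemma exists_isFourCycle_of_indep
    (hmin : ∀ T : Set V, IsDomSet G T → 2 ≤ crOf G T)
    {S : Set V} (hcard : ∀ T : Set V, IsDomSet G T → crOf G T = 2 → S.ncard ≤ T.ncard)
    {a b : V} (hab : a ≠ b) (hS : ∀ x, x ∈ S ↔ x ≠ a ∧ x ≠ b)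
    (hindep : ∀ x ∈ S, ∀ y ∈ S, ¬ G.Adj x y) (ha : IsOverdominated G S a) :
    ∃ p q r s, IsFourCycle G p q r s := by
  obtain ⟨hnab, hba⟩ := not_adj_and_adj_of_adj hmin hab hS hindep
  obtain ⟨hnba, hab'⟩ := not_adj_and_adj_of_adj hmin hab.symm (fun x => (hS x).trans and_comm)
    hindep
  obtain ⟨s, hs, t, ht, hst, has, hat⟩ := ha
  have has : G.Adj a s := has.resolve_left (by rintro rfl; simp [hS] at hs)
  have hat : G.Adj a t := hat.resolve_left (by rintro rfl; simp [hS] at ht)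
  have honly : ∀ w, G.Adj a w → w = s ∨ w = t := by
    intro w haw
    by_contra! hw
    have hwb : w ≠ b := by rintro rfl; exact hnab haw
    have hwS : w ∈ S := (hS w).2 ⟨haw.ne', hwb⟩
    set T : Set V := {x | x = s ∨ (x ≠ b ∧ ¬ G.Adj a x)} with hT
    have hdom : IsDomSet G T := by
      rw [isDomSet_iff]
      intro x
      by_cases hax : G.Adj a x
      · exact ⟨a, Or.inr ⟨hab, G.loopless.irrefl a⟩, Or.inr hax.symm⟩
      by_cases hxb : x = b
      · exact ⟨s, Or.inl rfl, Or.inr (hxb ▸ hab' s hs has)⟩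
      · exact ⟨x, Or.inr ⟨hxb, hax⟩, Or.inl rfl⟩
    have hle : crOf G T ≤ 2 := by
      refine crOf_le_two (x := a) (y := s) ?_
      rintro x ⟨y, hy, z, hz, hyz, hxy, hxz⟩
      simp only [hT, Set.mem_ofPred_eq] at hy hz
      have := hindep x
      have := G.adj_comm x a
      have := hba y
      have := hba z
      grind
    have hST := hcard T hdom (le_antisymm hle (hmin T hdom))
    have hlt : T.ncard < S.ncard := by
      have hsub : T ⊆ insert a (S \ {t, w}) := by
        intro x hx
        simp only [hT, Set.mem_ofPred_eq] at hx
        simp only [Set.mem_insert_iff, Set.mem_sdiff, Set.mem_singleton_iff, hS]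
        grind
      have h1 := Set.ncard_le_ncard hsub (Set.toFinite _)
      have h2 := Set.ncard_insert_le a (S \ {t, w})
      have h3 : ({t, w} : Set V) ⊆ S := by
        rintro x (rfl | rfl) <;> assumption
      have h4 := Set.ncard_sdiff_add_ncard_of_subset h3 (Set.toFinite _)
      rw [Set.ncard_pair (by grind)] at h4
      omega
    omega
  refine ⟨a, s, b, t, by grind, fun x y => ?_⟩
  have := hba x
  have := hba y
  have := hab' s hs has
  have := hab' t ht hat
  have := honly x
  have := honly y
  have := hindep x
  have := G.adj_comm x y
  have := G.adj_comm a s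
  have := G.adj_comm a t
  have := G.adj_comm b s
  have := G.adj_comm b t
  have := G.ne_of_adj (a := x) (b := y)
  grind

lemma exists_isFourCycle_of_crNum_eq_two {n : ℕ} (hcard : Nat.card V = n) (hn : 4 ≤ n)
    (h2 : crNum G = 2) (hγ : gammaCR G = n - 2) : ∃ p q r s, IsFourCycle G p q r s := by
  have hmin : ∀ T : Set V, IsDomSet G T → 2 ≤ crOf G T := fun T hT =>
    h2 ▸ Nat.sInf_le ⟨T, hT, rfl⟩
  have hmincard : ∀ T : Set V, IsDomSet G T → crOf G T = 2 → n - 2 ≤ T.ncard :=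
    fun T hT hT2 => hγ ▸ Nat.sInf_le ⟨T, hT, hT2.trans h2.symm, rfl⟩
  obtain ⟨S, hdom, hcr, hSn⟩ := Nat.sInf_mem (Nat.nonempty_of_pos_sInf
    (show 0 < gammaCR G by omega))
  change S.ncard = gammaCR G at hSn
  rw [hγ] at hSn
  rw [h2, crOf_eq_ncard] at hcr
  have hcompl : Sᶜ.ncard = 2 := by
    have := Set.ncard_add_ncard_compl S
    omega
  obtain ⟨a, b, hab, hSc⟩ := Set.ncard_eq_two.1 hcompl
  have hS : ∀ x, x ∈ S ↔ x ≠ a ∧ x ≠ b := by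
    intro x
    have := Set.ext_iff.1 hSc x
    simp only [Set.mem_compl_iff, Set.mem_insert_iff, Set.mem_singleton_iff] at this
    tauto
  obtain ⟨c, d, hcd, hO⟩ := Set.ncard_eq_two.1 hcr
  have hover : ∀ x, IsOverdominated G S x ↔ x = c ∨ x = d := fun x => Set.ext_iff.1 hO x
  by_cases hindep : ∀ x ∈ S, ∀ y ∈ S, ¬ G.Adj x y
  · refine exists_isFourCycle_of_indep hmin (fun T hT hT2 => hSn ▸ hmincard T hT hT2) hab hS
      hindep ?_
    have hmem : ∀ x, IsOverdominated G S x → x = a ∨ x = b := by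
      rintro x ⟨y, hy, z, hz, hyz, hxy, hxz⟩
      have := hindep x
      have := hS x
      grind
    have := hmem c ((hover c).2 (Or.inl rfl))
    have := hmem d ((hover d).2 (Or.inr rfl))
    rw [hover]
    grind
  · push Not at hindep
    obtain ⟨u, hu, v, hv, huv⟩ := hindep
    have hu' := (hover u).1 ⟨u, hu, v, hv, huv.ne, Or.inl rfl, Or.inr huv⟩
    have hv' := (hover v).1 ⟨u, hu, v, hv, huv.ne, Or.inr huv.symm, Or.inl rfl⟩
    refine exists_isFourCycle_of_adj hmin hab hS hdom hu hv huv fun x hx => ?_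
    have := (hover x).1 hx
    have := huv.ne
    grind

namespace IsFourCycle

variable {p q r s : V}

lemma two_le_crOf (h : IsFourCycle G p q r s) {S : Set V} (hS : IsDomSet G S) :
    2 ≤ crOf G S := by
  rw [two_le_crOf_iff]
  rw [isDomSet_iff] at hS
  obtain ⟨hne, hadj⟩ := h
  have hov : ∀ x y z, y ∈ S → z ∈ S → y ≠ z → (x = y ∨ G.Adj x y) → (x = z ∨ G.Adj x z) →
    IsOverdominated G S x := fun x y z hy hz hyz hxy hxz => ⟨y, hy, z, hz, hyz, hxy, hxz⟩
  have edge : ∀ x y, x ∈ S → y ∈ S → G.Adj x y →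
      ∃ x y, IsOverdominated G S x ∧ IsOverdominated G S y ∧ x ≠ y := fun x y hx hy hxy =>
    ⟨x, y, hov x x y hx hy hxy.ne (Or.inl rfl) (Or.inr hxy),
      hov y x y hx hy hxy.ne (Or.inr hxy.symm) (Or.inl rfl), hxy.ne⟩
  have hp := hS p
  have hq := hS q
  have hr := hS r
  have hs := hS s
  simp only [hadj] at hp hq hr hs
  have hcases : (p ∈ S ∧ q ∈ S) ∨ (q ∈ S ∧ r ∈ S) ∨ (r ∈ S ∧ s ∈ S) ∨ (s ∈ S ∧ p ∈ S) ∨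
      (p ∈ S ∧ r ∈ S) ∨ (q ∈ S ∧ s ∈ S) := by grind
  rcases hcases with ⟨h, h'⟩ | ⟨h, h'⟩ | ⟨h, h'⟩ | ⟨h, h'⟩ | ⟨h, h'⟩ | ⟨h, h'⟩
  · exact edge _ _ h h' (by simp [hadj])
  · exact edge _ _ h h' (by simp [hadj])
  · exact edge _ _ h h' (by simp [hadj])
  · exact edge _ _ h h' (by simp [hadj])
  · exact ⟨q, s, hov q p r h h' (by grind) (by simp [hadj]) (by simp [hadj]),
      hov s p r h h' (by grind) (by simp [hadj]) (by simp [hadj]), by grind⟩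
  · exact ⟨p, r, hov p q s h h' (by grind) (by simp [hadj]) (by simp [hadj]),
      hov r q s h h' (by grind) (by simp [hadj]) (by simp [hadj]), by grind⟩

lemma card_sub_two_le_ncard (h : IsFourCycle G p q r s) {S : Set V} (hS : IsDomSet G S) :
    Nat.card V - 2 ≤ S.ncard := by
  rw [isDomSet_iff] at hS
  obtain ⟨hne, hadj⟩ := h
  simp only [hadj] at hS
  have hle : Sᶜ.ncard ≤ 2 := by
    by_contra! hlt
    obtain ⟨x, y, z, hx, hy, hz, hxy, hxz, hyz⟩ := (Set.two_lt_ncard_iff (Set.toFinite _)).1 hlt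
    simp only [Set.mem_compl_iff] at hx hy hz
    have mem : ∀ v ∉ S, v = p ∨ v = q ∨ v = r ∨ v = s := fun v hv => by
      have := hS v
      grind
    have hp : p ∈ S ∨ q ∈ S ∨ s ∈ S := by have := hS p; grind
    have hq : q ∈ S ∨ p ∈ S ∨ r ∈ S := by have := hS q; grind
    have hr : r ∈ S ∨ q ∈ S ∨ s ∈ S := by have := hS r; grind
    have hs : s ∈ S ∨ r ∈ S ∨ p ∈ S := by have := hS s; grind
    have := mem x hx
    have := mem y hy
    have := mem z hz
    clear hS mem hadj
    grind
  have := Set.ncard_add_ncard_compl S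
  omega

omit [Finite V] in
lemma isDomSet_compl_pair (h : IsFourCycle G p q r s) : IsDomSet G ({r, s}ᶜ : Set V) := by
  rw [isDomSet_iff]
  obtain ⟨hne, hadj⟩ := h
  intro x
  simp only [hadj, Set.mem_compl_iff, Set.mem_insert_iff, Set.mem_singleton_iff]
  by_cases hr : x = r
  · exact ⟨q, by grind⟩
  by_cases hs : x = s
  · exact ⟨p, by grind⟩
  · exact ⟨x, by grind⟩

lemma crOf_compl_pair (h : IsFourCycle G p q r s) : crOf G ({r, s}ᶜ : Set V) = 2 := by
  refine le_antisymm (crOf_le_two (x := p) (y := q) ?_) (h.two_le_crOf h.isDomSet_compl_pair)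
  obtain ⟨hne, hadj⟩ := h
  rintro x ⟨y, hy, z, hz, hyz, hxy, hxz⟩
  simp only [hadj, Set.mem_compl_iff, Set.mem_insert_iff, Set.mem_singleton_iff] at *
  grind

lemma crNum_eq_two (h : IsFourCycle G p q r s) : crNum G = 2 := by
  refine le_antisymm (Nat.sInf_le ⟨_, h.isDomSet_compl_pair, h.crOf_compl_pair⟩) ?_
  refine le_csInf ⟨_, _, h.isDomSet_compl_pair, rfl⟩ ?_
  rintro _ ⟨S, hS, rfl⟩
  exact h.two_le_crOf hS

lemma gammaCR_eq (h : IsFourCycle G p q r s) : gammaCR G = Nat.card V - 2 := by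
  have hcr := h.crOf_compl_pair.trans h.crNum_eq_two.symm
  have hcard : ({r, s}ᶜ : Set V).ncard = Nat.card V - 2 := by
    have := Set.ncard_add_ncard_compl ({r, s} : Set V)
    rw [Set.ncard_pair h.1.2.2.2.2.2] at this
    omega
  refine le_antisymm (Nat.sInf_le ⟨_, h.isDomSet_compl_pair, hcr, hcard⟩) ?_
  refine le_csInf ⟨_, _, h.isDomSet_compl_pair, hcr, rfl⟩ ?_
  rintro _ ⟨S, hS, -, rfl⟩
  exact h.card_sub_two_le_ncard hS

omit [Finite V] in
lemma of_iso {W : Type*} {H : SimpleGraph W} {p q r s : W} (h : IsFourCycle H p q r s)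
    (e : G ≃g H) : IsFourCycle G (e.symm p) (e.symm q) (e.symm r) (e.symm s) := by
  obtain ⟨hne, hadj⟩ := h
  refine ⟨by simpa using hne, fun x y => ?_⟩
  rw [← e.map_adj_iff, hadj]
  simp only [RelIso.eq_symm_apply]

end IsFourCycle

end

lemma isFourCycle_c4UnionIsolated {n : ℕ} (hn : 4 ≤ n) :
    IsFourCycle (c4UnionIsolated n) ⟨0, by omega⟩ ⟨1, by omega⟩ ⟨2, by omega⟩ ⟨3, by omega⟩ := by
  refine ⟨by simp, fun x y => ?_⟩
  simp only [c4UnionIsolated, fromRel_adj, ne_eq, Fin.ext_iff]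
  omega

lemma IsFourCycle.nonempty_iso {V W : Type*} [Fintype V] [Fintype W] {G : SimpleGraph V}
    {H : SimpleGraph W} {p q r s : V} {p' q' r' s' : W} (hG : IsFourCycle G p q r s)
    (hH : IsFourCycle H p' q' r' s') (hcard : Fintype.card V = Fintype.card W) :
    Nonempty (G ≃g H) := by
  classical
  obtain ⟨hne, hadj⟩ := hG
  obtain ⟨hne', hadj'⟩ := hH
  obtain ⟨g, hg⟩ := Finset.exists_equiv_extend_of_card_eq (t := (Finset.univ : Finset W))
    (s := {p, q, r, s})
    (f := fun x => if x = p then p' else if x = q then q' else if x = r then r' else s')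
    (by simpa using hcard) (Finset.subset_univ _) (by
      intro x hx y hy hxy
      simp only [Finset.coe_insert, Finset.coe_singleton, Set.mem_insert_iff,
        Set.mem_singleton_iff] at hx hy
      grind)
  let e : V ≃ W := g.trans (Equiv.subtypeUnivEquiv Finset.mem_univ)
  have he : ∀ x, e x = g x := fun x => rfl
  have hp : e p = p' := by rw [he, hg p (by simp)]; simp
  have hq : e q = q' := by rw [he, hg q (by simp)]; grind
  have hr : e r = r' := by rw [he, hg r (by simp)]; grind
  have hs : e s = s' := by rw [he, hg s (by simp)]; grind
  refine ⟨e, fun {x y} => ?_⟩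
  rw [hadj, hadj', ← hp, ← hq, ← hr, ← hs]
  simp only [e.apply_eq_iff_eq]

theorem crNum_two_gammaCR_card_sub_two_iff {V : Type*} [Fintype V]
    (G : SimpleGraph V) (n : ℕ) (hcard : Fintype.card V = n) (hn : 4 ≤ n) :
    (crNum G = 2 ∧ gammaCR G = n - 2) ↔ Nonempty (G ≃g c4UnionIsolated n) := by
  have hcard' : Nat.card V = n := Nat.card_eq_fintype_card.trans hcard
  constructor
  · rintro ⟨h2, hγ⟩
    obtain ⟨p, q, r, s, h⟩ := exists_isFourCycle_of_crNum_eq_two hcard' hn h2 hγ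
    exact h.nonempty_iso (isFourCycle_c4UnionIsolated hn) (by simpa using hcard)
  · rintro ⟨e⟩
    have h := (isFourCycle_c4UnionIsolated hn).of_iso e
    exact ⟨h.crNum_eq_two, hcard' ▸ h.gammaCR_eq⟩
end

section
/- Let n ≥ 8 be an integer and let m be an integer. Then the maximum of γ_CR(G) over all finite simple graphs G of order n with m edges and CR(G) = 2 equals: n − 2 if m = 4; n − 3 if 5 ≤ m ≤ 7; and n − 4 if 8 ≤ m ≤ 2(n − 6) + 10. -/
open SimpleGraph Set

/-- `IsMaxGamma n m M` : among all graphs of order `n` with `m` edges and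
`CR(G) = 2`, the maximum value of `γ_CR(G)` is `M`. -/
def IsMaxGamma (n m M : ℕ) : Prop :=
  (∀ (V : Type) [Fintype V] (G : SimpleGraph V), Fintype.card V = n →
      G.edgeSet.ncard = m → crNum G = 2 → gammaCR G ≤ M) ∧
  (∃ G : SimpleGraph (Fin n), G.edgeSet.ncard = m ∧ crNum G = 2 ∧ gammaCR G = M)

section UpperBound

variable {V : Type*} {G : SimpleGraph V}

theorem crOf_le_card_of_unique [Finite V] {S : Set V} (P : Finset V)
    (h : ∀ v ∉ P, ∀ s ∈ S, ∀ s' ∈ S, v ∈ closedNbhd G s → v ∈ closedNbhd G s' → s = s') :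
    crOf G S ≤ P.card := by
  rw [← Set.ncard_coe_finset]
  refine Set.ncard_le_ncard ?_ (Set.toFinite _)
  intro v hv
  obtain ⟨s, s', hs, hs', hne⟩ :=
    (Set.one_lt_ncard_iff (Set.toFinite _)).1 (show 1 < (closedNbhd G v ∩ S).ncard from hv)
  by_contra hvP
  refine hne (h v hvP s hs.2 s' hs'.2 ?_ ?_)
  · exact hs.1.imp Eq.symm G.adj_symm
  · exact hs'.1.imp Eq.symm G.adj_symm

/-- A dominating set overdominating at most two vertices, of minimum cardinality among all such
sets. The last field records that fewer than two overdominated vertices are impossible. -/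
structure IsMinTwo (G : SimpleGraph V) (S : Finset V) : Prop where
  dom : ∀ v, ∃ s ∈ S, s = v ∨ G.Adj s v
  le_card : ∀ (S' : Finset V) (p q : V), (∀ v, ∃ s ∈ S', s = v ∨ G.Adj s v) →
    (∀ v, v ≠ p → v ≠ q → ∀ s ∈ S', ∀ s' ∈ S', (s = v ∨ G.Adj s v) → (s' = v ∨ G.Adj s' v) →
      s = s') → p ≠ q ∧ S.card ≤ S'.card

theorem two_le_card_filter [DecidableRel G.Adj] {S : Finset V} {v : V} (hv : v ∉ S)
    (h : ∃ s ∈ S, ∃ s' ∈ S, s ≠ s' ∧ (s = v ∨ G.Adj s v) ∧ (s' = v ∨ G.Adj s' v)) :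
    2 ≤ {s ∈ S | G.Adj v s}.card := by
  obtain ⟨s, hs, s', hs', hne, h1, h2⟩ := h
  have h1' : G.Adj v s := (h1.resolve_left fun h => hv (h ▸ hs)).symm
  have h2' : G.Adj v s' := (h2.resolve_left fun h => hv (h ▸ hs')).symm
  exact Finset.one_lt_card.2 ⟨s, by simp [hs, h1'], s', by simp [hs', h2'], hne⟩

theorem card_filter_le_one [DecidableRel G.Adj] {S : Finset V} {v : V}
    (h : ¬ ∃ s ∈ S, ∃ s' ∈ S, s ≠ s' ∧ (s = v ∨ G.Adj s v) ∧ (s' = v ∨ G.Adj s' v)) :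
    {s ∈ S | G.Adj v s}.card ≤ 1 := by
  rw [Finset.card_le_one]
  grind [SimpleGraph.Adj.symm]

variable [DecidableEq V] {S : Finset V}

theorem IsMinTwo.card_le_two (hS : IsMinTwo G S) {A : Finset V} {R : Finset V} (hR : R.card ≤ 2)
    (hA : A ⊆ S) (p q : V)
    (hdom : ∀ v, ∃ s ∈ (S \ A) ∪ R, s = v ∨ G.Adj s v)
    (huniq : ∀ v, v ≠ p → v ≠ q → ∀ s ∈ (S \ A) ∪ R, ∀ s' ∈ (S \ A) ∪ R, (s = v ∨ G.Adj s v) →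
      (s' = v ∨ G.Adj s' v) → s = s') : A.card ≤ 2 := by
  have h1 := (hS.le_card _ p q hdom huniq).2
  have h2 := Finset.card_union_le (S \ A) R
  have h3 := Finset.card_sdiff_add_card_eq_card hA
  omega

theorem exists_eq_of_card_eq_three {T : Finset V} (hT : T.card = 3) {p q : V} (hpq : p ≠ q)
    (hsub : {p, q} ⊆ T) : ∃ z, z ≠ p ∧ z ≠ q ∧ T = {p, q, z} := by
  obtain ⟨z, hz⟩ : ∃ z, T \ {p, q} = {z} := by
    rw [← Finset.card_eq_one, Finset.card_sdiff_of_subset hsub, Finset.card_pair hpq, hT]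
  have hmem : z ∈ T \ {p, q} := hz ▸ Finset.mem_singleton_self z
  simp only [Finset.mem_sdiff, Finset.mem_insert, Finset.mem_singleton, not_or] at hmem
  refine ⟨z, hmem.2.1, hmem.2.2, ?_⟩
  rw [← Finset.union_sdiff_of_subset hsub, hz]
  simp [Finset.insert_union]

variable [DecidableRel G.Adj]

theorem IsMinTwo.exchange (hS : IsMinTwo G S) (x r r' p q : V)
    (hdom : ∀ v, ∃ s, (s ∈ S ∧ ¬ G.Adj x s ∨ s = r ∨ s = r') ∧ (s = v ∨ G.Adj s v))
    (huniq : ∀ v, v ≠ p → v ≠ q → ∀ s s', (s ∈ S ∧ ¬ G.Adj x s ∨ s = r ∨ s = r') →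
      (s' ∈ S ∧ ¬ G.Adj x s' ∨ s' = r ∨ s' = r') → (s = v ∨ G.Adj s v) →
      (s' = v ∨ G.Adj s' v) → s = s') : {s ∈ S | G.Adj x s}.card ≤ 2 := by
  have hmem : ∀ s, s ∈ (S \ {s ∈ S | G.Adj x s}) ∪ {r, r'} ↔
      (s ∈ S ∧ ¬ G.Adj x s ∨ s = r ∨ s = r') := by
    intro s
    simp only [Finset.mem_union, Finset.mem_sdiff, Finset.mem_filter, Finset.mem_singleton,
      Finset.mem_insert]
    tauto
  refine hS.card_le_two (R := {r, r'}) Finset.card_le_two (Finset.filter_subset _ _) p q ?_ ?_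
  · intro v
    obtain ⟨s, hs⟩ := hdom v
    exact ⟨s, (hmem s).2 hs.1, hs.2⟩
  · intro v hp hq s hs s' hs'
    exact huniq v hp hq s s' ((hmem s).1 hs) ((hmem s').1 hs')

theorem IsMinTwo.two_outside (hS : IsMinTwo G S) (hind : ∀ s ∈ S, ∀ s' ∈ S, ¬ G.Adj s s')
    {x y : V} (hx : x ∉ S) (hy : y ∉ S) (hV : ∀ v, v ∈ S ∨ v = x ∨ v = y)
    (hA : 2 ≤ {s ∈ S | G.Adj x s}.card) (hB : 2 ≤ {s ∈ S | G.Adj y s}.card) :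
    ¬ G.Adj x y ∧ {s ∈ S | G.Adj x s} ⊆ {s ∈ S | G.Adj y s} ∧ {s ∈ S | G.Adj x s}.card ≤ 2 := by
  have key : ∀ x y : V, x ∉ S → y ∉ S → (∀ v, v ∈ S ∨ v = x ∨ v = y) →
      2 ≤ {s ∈ S | G.Adj x s}.card →
      ¬ G.Adj x y ∧ ∀ s ∈ S, G.Adj y s → G.Adj x s := by
    intro x y hx hy hV hA
    by_contra hcon
    have := (hS.le_card ((S \ {s ∈ S | G.Adj x s}) ∪ {x}) y y ?_ ?_).1
    · exact this rfl
    · simp only [Finset.mem_union, Finset.mem_sdiff, Finset.mem_filter, Finset.mem_singleton]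
      grind [SimpleGraph.Adj.symm, SimpleGraph.irrefl]
    · simp only [Finset.mem_union, Finset.mem_sdiff, Finset.mem_filter, Finset.mem_singleton]
      grind [SimpleGraph.Adj.symm, SimpleGraph.irrefl]
  have k1 := key x y hx hy hV hA
  have k2 := key y x hy hx (by grind) hB
  refine ⟨k1.1, fun s => by simpa using fun h1 h2 => ⟨h1, k2.2 s h1 h2⟩, ?_⟩
  obtain ⟨a, ha⟩ := Finset.card_pos.1 (show 0 < {s ∈ S | G.Adj x s}.card by omega)
  rw [Finset.mem_filter] at ha
  refine hS.card_le_two (R := {x, a}) Finset.card_le_two (Finset.filter_subset _ _) x a ?_ ?_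
  · simp only [Finset.mem_union, Finset.mem_sdiff, Finset.mem_filter, Finset.mem_singleton,
      Finset.mem_insert]
    grind [SimpleGraph.Adj.symm, SimpleGraph.irrefl]
  · simp only [Finset.mem_union, Finset.mem_sdiff, Finset.mem_filter, Finset.mem_singleton,
      Finset.mem_insert]
    grind [SimpleGraph.Adj.symm, SimpleGraph.irrefl]

theorem IsMinTwo.three_outside_disj (hS : IsMinTwo G S) (hind : ∀ s ∈ S, ∀ s' ∈ S, ¬ G.Adj s s')
    {x y z c : V} (hx : x ∉ S)
    (hV : ∀ v, v ∈ S ∨ v = x ∨ v = y ∨ v = z) (hc : c ∈ S) (hzc : ∀ s ∈ S, G.Adj z s ↔ s = c)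
    (hA : 2 ≤ {s ∈ S | G.Adj x s}.card) :
    ((∀ s ∈ S, G.Adj y s → G.Adj x s) ∧ ¬ G.Adj x y) ∨ (G.Adj x c ∧ ¬ G.Adj x z) := by
  by_contra hcon
  have := (hS.le_card ((S \ {s ∈ S | G.Adj x s}) ∪ {x}) y z ?_ ?_).2
  · have h2 := Finset.card_union_le (S \ {s ∈ S | G.Adj x s}) {x}
    have h3 := Finset.card_sdiff_add_card_eq_card (Finset.filter_subset (fun s => G.Adj x s) S)
    rw [Finset.card_singleton] at h2
    omega
  · simp only [Finset.mem_union, Finset.mem_sdiff, Finset.mem_filter, Finset.mem_singleton]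
    grind [SimpleGraph.Adj.symm, SimpleGraph.irrefl]
  · simp only [Finset.mem_union, Finset.mem_sdiff, Finset.mem_filter, Finset.mem_singleton]
    grind [SimpleGraph.Adj.symm, SimpleGraph.irrefl]

theorem IsMinTwo.three_outside_card (hS : IsMinTwo G S) (hind : ∀ s ∈ S, ∀ s' ∈ S, ¬ G.Adj s s')
    {x y z c : V} (hx : x ∉ S) (hy : y ∉ S) (hz : z ∉ S)
    (hV : ∀ v, v ∈ S ∨ v = x ∨ v = y ∨ v = z) (hc : c ∈ S) (hzc : ∀ s ∈ S, G.Adj z s ↔ s = c)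
    (hA : 2 ≤ {s ∈ S | G.Adj x s}.card) (hB : 2 ≤ {s ∈ S | G.Adj y s}.card) :
    {s ∈ S | G.Adj x s}.card ≤ 2 := by
  have d1 := hS.three_outside_disj hind hx hV hc hzc hA
  have d2 := hS.three_outside_disj hind (x := y) (y := x) hy (by grind) hc hzc hB
  obtain ⟨a, ha, hac⟩ := Finset.exists_mem_ne (show 1 < {s ∈ S | G.Adj x s}.card by omega) c
  obtain ⟨b, hb, hbc⟩ := Finset.exists_mem_ne (show 1 < {s ∈ S | G.Adj y s}.card by omega) c
  rw [Finset.mem_filter] at ha hb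
  by_cases hBA : (∀ s ∈ S, G.Adj y s → G.Adj x s) ∧ ¬ G.Adj x y
  · by_cases hxz' : G.Adj x z
    · rcases d2 with hAB | hcB
      · by_cases hcA : G.Adj x c
        · refine hS.exchange x x a x a ?_ ?_ <;> grind [SimpleGraph.Adj.symm, SimpleGraph.irrefl]
        · by_cases hyz' : G.Adj y z
          · have hcA' : c ∉ {s ∈ S | G.Adj x s} := by simp [hcA]
            have := hS.card_le_two (A := insert c {s ∈ S | G.Adj x s}) (R := {x, z})
              Finset.card_le_two ?_ x z ?_ ?_
            · rw [Finset.card_insert_of_notMem hcA'] at this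
              omega
            · exact Finset.insert_subset hc (Finset.filter_subset _ _)
            all_goals
              simp only [Finset.mem_union, Finset.mem_sdiff, Finset.mem_filter,
                Finset.mem_singleton, Finset.mem_insert]
              grind [SimpleGraph.Adj.symm, SimpleGraph.irrefl]
          · have hEq : {s ∈ S | G.Adj x s} = {s ∈ S | G.Adj y s} := by grind
            rw [hEq]
            refine hS.exchange y y a y a ?_ ?_ <;> grind [SimpleGraph.Adj.symm, SimpleGraph.irrefl]
      · refine hS.exchange x x b x b ?_ ?_ <;> grind [SimpleGraph.Adj.symm, SimpleGraph.irrefl]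
    · by_cases hcA : G.Adj x c
      · refine hS.exchange x x c x c ?_ ?_ <;> grind [SimpleGraph.Adj.symm, SimpleGraph.irrefl]
      · refine hS.exchange x x a x a ?_ ?_ <;> grind [SimpleGraph.Adj.symm, SimpleGraph.irrefl]
  · rcases d2 with hAB | hcB
    · refine (Finset.card_le_card (t := {s ∈ S | G.Adj y s}) (by grind)).trans ?_
      by_cases hyz' : G.Adj y z
      · refine hS.exchange y y a y a ?_ ?_ <;> grind [SimpleGraph.Adj.symm, SimpleGraph.irrefl]
      · refine hS.exchange y y c y c ?_ ?_ <;> grind [SimpleGraph.Adj.symm, SimpleGraph.irrefl]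
    · refine hS.exchange x x z c y ?_ ?_ <;> grind [SimpleGraph.Adj.symm, SimpleGraph.irrefl]

theorem two_mul_ncard_edgeSet_eq_s18 [Fintype V] (G : SimpleGraph V) [DecidableRel G.Adj]
    (S : Finset V) :
    2 * G.edgeSet.ncard = ∑ v ∈ S, {s ∈ S | G.Adj v s}.card +
      2 * ∑ v ∈ Sᶜ, {s ∈ S | G.Adj v s}.card + ∑ v ∈ Sᶜ, {s ∈ Sᶜ | G.Adj v s}.card := by
  have h1 : G.edgeSet.ncard = G.edgeFinset.card := by
    rw [← SimpleGraph.coe_edgeFinset, Set.ncard_coe_finset]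
  have h2 : ∀ v, G.degree v = {s ∈ S | G.Adj v s}.card + {s ∈ Sᶜ | G.Adj v s}.card := by
    intro v
    simp only [Finset.card_filter]
    rw [Finset.sum_add_sum_compl, ← Finset.card_filter, ← SimpleGraph.card_neighborFinset_eq_degree]
    congr 1
    ext u
    simp
  have h3 : ∑ v ∈ S, {s ∈ Sᶜ | G.Adj v s}.card = ∑ v ∈ Sᶜ, {s ∈ S | G.Adj v s}.card := by
    simp only [Finset.card_filter]
    rw [Finset.sum_comm]
    simp only [G.adj_comm]
  rw [h1, ← G.sum_degrees_eq_twice_card_edges, ← Finset.sum_add_sum_compl S]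
  simp only [h2, Finset.sum_add_distrib, h3]
  ring

theorem exists_isMinTwo [Fintype V] (G : SimpleGraph V) (h : crNum G = 2) :
    ∃ S : Finset V, S.card = gammaCR G ∧ IsMinTwo G S ∧ ∃ p q, p ≠ q ∧
      ∀ v, (v = p ∨ v = q) ↔ ∃ s ∈ S, ∃ s' ∈ S, s ≠ s' ∧ (s = v ∨ G.Adj s v) ∧
        (s' = v ∨ G.Adj s' v) := by
  classical
  have hne : {k : ℕ | ∃ S : Set V, IsDomSet G S ∧ crOf G S = k}.Nonempty := by
    by_contra hcon
    rw [Set.not_nonempty_iff_eq_empty] at hcon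
    rw [crNum, hcon, Nat.sInf_empty] at h
    omega
  obtain ⟨S₀, hS₀, hcr₀⟩ := Nat.sInf_mem hne
  have hne' : {r : ℕ | ∃ S : Set V, IsDomSet G S ∧ crOf G S = crNum G ∧ S.ncard = r}.Nonempty :=
    ⟨_, S₀, hS₀, hcr₀, rfl⟩
  obtain ⟨S, hS, hcr, hcard⟩ := Nat.sInf_mem hne'
  have hdom : ∀ S' : Set V, IsDomSet G S' ↔ ∀ v, ∃ s ∈ S', s = v ∨ G.Adj s v := by
    intro S'
    simp only [IsDomSet, closedNbhd, Set.mem_insert_iff, SimpleGraph.mem_neighborSet, eq_comm]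
  refine ⟨S.toFinset, ?_, ⟨?_, ?_⟩, ?_⟩
  · rw [← Set.ncard_eq_toFinset_card', hcard]
    rfl
  · simpa using (hdom S).1 hS
  · intro S' p q hd hu
    have hd' : IsDomSet G (S' : Set V) := (hdom _).2 (by simpa using hd)
    have hu' : ∀ v, v ≠ p → v ≠ q → ∀ s ∈ (S' : Set V), ∀ s' ∈ (S' : Set V),
        v ∈ closedNbhd G s → v ∈ closedNbhd G s' → s = s' := by
      intro v hp hq s hs s' hs' h1 h2
      refine hu v hp hq s hs s' hs' ?_ ?_
      · simpa [closedNbhd, eq_comm] using h1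
      · simpa [closedNbhd, eq_comm] using h2
    have h2 : 2 ≤ crOf G (S' : Set V) := h ▸ Nat.sInf_le ⟨_, hd', rfl⟩
    refine ⟨?_, ?_⟩
    · rintro rfl
      have := crOf_le_card_of_unique {p} fun v hv => hu' v (by simpa using hv) (by simpa using hv)
      simp at this
      omega
    · have h3 := crOf_le_card_of_unique {p, q} fun v hv => hu' v (by grind) (by grind)
      have h4 := Finset.card_le_two (a := p) (b := q)
      have := Nat.sInf_le (s := {r : ℕ | ∃ S : Set V, IsDomSet G S ∧ crOf G S = crNum G ∧
        S.ncard = r}) ⟨(S' : Set V), hd', by omega, rfl⟩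
      rw [← Set.ncard_eq_toFinset_card', hcard]
      simpa using this
  · rw [h] at hcr
    obtain ⟨p, q, hpq, heq⟩ := Set.ncard_eq_two.1 hcr
    refine ⟨p, q, hpq, fun v => ?_⟩
    have h1 : v ∈ ({p, q} : Set V) ↔ v = p ∨ v = q := by simp
    rw [← h1, ← heq]
    simp only [Set.mem_ofPred_eq, Set.mem_toFinset]
    rw [← Nat.lt_iff_add_one_le, Set.one_lt_ncard_iff (Set.toFinite _)]
    simp only [closedNbhd, Set.mem_inter_iff, Set.mem_insert_iff, SimpleGraph.mem_neighborSet]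
    grind [SimpleGraph.Adj.symm]

theorem le_seven_of_edge_count {m : ℕ} {p q z : V} (hpq : p ≠ q) (hpz : p ≠ z) (hqz : q ≠ z)
    (hp : {s ∈ S | G.Adj p s}.card ≤ 2) (hq : {s ∈ S | G.Adj q s}.card ≤ 2)
    (hz : {s ∈ S | G.Adj z s}.card ≤ 1) (htri : ¬ (G.Adj p q ∧ G.Adj p z))
    (h : 2 * m = 0 + 2 * ∑ v ∈ {p, q, z}, {s ∈ S | G.Adj v s}.card +
      ∑ v ∈ {p, q, z}, {s ∈ ({p, q, z} : Finset V) | G.Adj v s}.card) : m ≤ 7 := by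
  have hpq' : p ∉ ({q, z} : Finset V) := by simp [hpq, hpz]
  have hqz' : q ∉ ({z} : Finset V) := by simpa using hqz
  simp only [Finset.sum_insert hpq', Finset.sum_insert hqz', Finset.sum_singleton] at h
  simp only [Finset.card_filter _ ({p, q, z} : Finset V), Finset.sum_insert hpq',
    Finset.sum_insert hqz', Finset.sum_singleton, SimpleGraph.irrefl, if_false,
    G.adj_comm q p, G.adj_comm z p, G.adj_comm z q] at h
  split_ifs at h <;> first | omega | tauto

theorem ncard_edgeSet_le_of_indep [Fintype V] (hS : IsMinTwo G S)
    (hind : ∀ s ∈ S, ∀ s' ∈ S, ¬ G.Adj s s') {p q : V} (hpq : p ≠ q)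
    (hover : ∀ v, (v = p ∨ v = q) ↔
      ∃ s ∈ S, ∃ s' ∈ S, s ≠ s' ∧ (s = v ∨ G.Adj s v) ∧ (s' = v ∨ G.Adj s' v)) :
    (Sᶜ.card ≤ 1 → G.edgeSet.ncard ≤ 3) ∧ (Sᶜ.card = 2 → G.edgeSet.ncard ≤ 4) ∧
      (Sᶜ.card = 3 → G.edgeSet.ncard ≤ 7) := by
  have hedge := two_mul_ncard_edgeSet_eq_s18 G S
  have hp := (hover p).1 (Or.inl rfl)
  have hq := (hover q).1 (Or.inr rfl)
  have hpS : p ∉ S := by grind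
  have hqS : q ∉ S := by grind
  have hpA := two_le_card_filter hpS hp
  have hqA := two_le_card_filter hqS hq
  have hzero : ∑ v ∈ S, {s ∈ S | G.Adj v s}.card = 0 := by
    refine Finset.sum_eq_zero fun v hv => ?_
    rw [Finset.card_eq_zero, Finset.filter_eq_empty_iff]
    exact fun s hs => hind v hv s hs
  have hsub : {p, q} ⊆ Sᶜ := by
    intro v hv
    simp only [Finset.mem_insert, Finset.mem_singleton] at hv
    rcases hv with rfl | rfl <;> simpa
  have hcard2 := Finset.card_pair hpq
  refine ⟨fun ht => ?_, fun ht => ?_, fun ht => ?_⟩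
  · have := Finset.card_le_card hsub
    omega
  · have hT := Finset.eq_of_subset_of_card_le hsub (by omega)
    have hV : ∀ v, v ∈ S ∨ v = p ∨ v = q := by
      intro v
      have := Finset.ext_iff.1 hT v
      simp only [Finset.mem_insert, Finset.mem_singleton, Finset.mem_compl] at this
      tauto
    have h1 := hS.two_outside hind hpS hqS hV hpA hqA
    have h2 := hS.two_outside hind hqS hpS (by grind) hqA hpA
    rw [hzero, ← hT, Finset.sum_pair hpq, Finset.sum_pair hpq] at hedge
    simp only [Finset.filter_insert, Finset.filter_singleton, h1.1, h2.1, SimpleGraph.irrefl,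
      if_false, Finset.card_empty] at hedge
    omega
  · obtain ⟨z, hzp, hzq, hT⟩ := exists_eq_of_card_eq_three ht hpq hsub
    have hzS : z ∉ S := by
      rw [← Finset.mem_compl, hT]
      simp
    have hV : ∀ v, v ∈ S ∨ v = p ∨ v = q ∨ v = z := by
      intro v
      by_cases hv : v ∈ S
      · exact Or.inl hv
      · rw [← Finset.mem_compl, hT] at hv
        exact Or.inr (by simpa using hv)
    obtain ⟨c, hc, hcz⟩ := hS.dom z
    have hzc : ∀ s ∈ S, G.Adj z s ↔ s = c := by
      have hz := (hover z).2
      have hcz' : G.Adj c z := hcz.resolve_left fun h => hzS (h ▸ hc)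
      refine fun s hs => ⟨fun h => ?_, fun h => h ▸ hcz'.symm⟩
      by_contra hne
      rcases hz ⟨s, hs, c, hc, hne, Or.inr h.symm, hcz⟩ with h | h
      · exact hzp h
      · exact hzq h
    have hz1 := card_filter_le_one (S := S) (v := z) fun h => by
      simpa [hzp, hzq] using (hover z).2 h
    have h1 := hS.three_outside_card hind hpS hqS hzS hV hc hzc hpA hqA
    have h2 := hS.three_outside_card hind hqS hpS hzS (by grind) hc hzc hqA hpA
    have h3 := hS.three_outside_disj hind hpS hV hc hzc hpA
    have htri : ¬ (G.Adj p q ∧ G.Adj p z) := by tauto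
    rw [hzero, hT] at hedge
    exact le_seven_of_edge_count hpq hzp.symm hzq.symm h1 h2 hz1 htri hedge

theorem ncard_edgeSet_le_of_adj [Fintype V]
    (hind : ¬ ∀ s ∈ S, ∀ s' ∈ S, ¬ G.Adj s s') {p q : V}
    (hover : ∀ v, (v = p ∨ v = q) ↔
      ∃ s ∈ S, ∃ s' ∈ S, s ≠ s' ∧ (s = v ∨ G.Adj s v) ∧ (s' = v ∨ G.Adj s' v)) :
    (Sᶜ.card ≤ 1 → G.edgeSet.ncard ≤ 3) ∧ (Sᶜ.card = 2 → G.edgeSet.ncard ≤ 4) ∧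
      (Sᶜ.card = 3 → G.edgeSet.ncard ≤ 7) := by
  have hedge := two_mul_ncard_edgeSet_eq_s18 G S
  have hpqS : p ∈ S ∧ q ∈ S ∧ ∀ s ∈ S, ∀ s' ∈ S, G.Adj s s' →
      (s, s') = (p, q) ∨ (s, s') = (q, p) := by
    push Not at hind
    obtain ⟨s, hs, s', hs', hadj⟩ := hind
    have key : ∀ s ∈ S, ∀ s' ∈ S, G.Adj s s' → (s, s') = (p, q) ∨ (s, s') = (q, p) := by
      intro s hs s' hs' hadj
      have h1 := (hover s).2 ⟨s, hs, s', hs', hadj.ne, Or.inl rfl, Or.inr hadj.symm⟩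
      have h2 := (hover s').2 ⟨s, hs, s', hs', hadj.ne, Or.inr hadj, Or.inl rfl⟩
      have h3 := hadj.ne
      grind
    refine ⟨?_, ?_, key⟩ <;> grind
  have hSS : ∑ v ∈ S, {s ∈ S | G.Adj v s}.card ≤ 2 := by
    rw [← Finset.card_sigma]
    refine (Finset.card_le_card (t := {⟨p, q⟩, ⟨q, p⟩}) ?_).trans Finset.card_le_two
    rintro ⟨s, s'⟩ h
    simp only [Finset.mem_sigma, Finset.mem_filter] at h
    have := hpqS.2.2 s h.1 s' h.2.1 h.2.2
    simpa using this
  have hTS : ∑ v ∈ Sᶜ, {s ∈ S | G.Adj v s}.card ≤ Sᶜ.card * 1 := by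
    refine Finset.sum_le_card_nsmul _ _ _ fun v hv => ?_
    rw [Finset.mem_compl] at hv
    refine card_filter_le_one fun h => ?_
    rcases (hover v).2 h with rfl | rfl
    · exact hv hpqS.1
    · exact hv hpqS.2.1
  have hTT : ∑ v ∈ Sᶜ, {s ∈ Sᶜ | G.Adj v s}.card ≤ Sᶜ.card * (Sᶜ.card - 1) := by
    refine Finset.sum_le_card_nsmul _ _ _ fun v hv => ?_
    rw [← Finset.card_erase_of_mem hv]
    refine Finset.card_le_card fun s hs => ?_
    rw [Finset.mem_filter] at hs
    exact Finset.mem_erase.2 ⟨hs.2.ne', hs.1⟩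
  refine ⟨fun ht => ?_, fun ht => ?_, fun ht => ?_⟩
  · interval_cases hcard : Sᶜ.card <;> omega
  · rw [ht] at hTS hTT
    omega
  · rw [ht] at hTS hTT
    omega

theorem ncard_edgeSet_le [Fintype V] (hS : IsMinTwo G S) {p q : V} (hpq : p ≠ q)
    (hover : ∀ v, (v = p ∨ v = q) ↔
      ∃ s ∈ S, ∃ s' ∈ S, s ≠ s' ∧ (s = v ∨ G.Adj s v) ∧ (s' = v ∨ G.Adj s' v)) :
    (Sᶜ.card ≤ 1 → G.edgeSet.ncard ≤ 3) ∧ (Sᶜ.card = 2 → G.edgeSet.ncard ≤ 4) ∧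
      (Sᶜ.card = 3 → G.edgeSet.ncard ≤ 7) := by
  by_cases hind : ∀ s ∈ S, ∀ s' ∈ S, ¬ G.Adj s s'
  · exact ncard_edgeSet_le_of_indep hS hind hpq hover
  · exact ncard_edgeSet_le_of_adj hind hover

end UpperBound

theorem gammaCR_upper {V : Type*} [Fintype V] (G : SimpleGraph V) (h : crNum G = 2) :
    (4 ≤ G.edgeSet.ncard → gammaCR G ≤ Fintype.card V - 2) ∧
      (5 ≤ G.edgeSet.ncard → gammaCR G ≤ Fintype.card V - 3) ∧
      (8 ≤ G.edgeSet.ncard → gammaCR G ≤ Fintype.card V - 4) := by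
  classical
  obtain ⟨S, hcard, hS, p, q, hpq, hover⟩ := exists_isMinTwo G h
  have h1 := ncard_edgeSet_le hS hpq hover
  have h2 := Finset.card_compl_add_card S
  refine ⟨fun hm => ?_, fun hm => ?_, fun hm => ?_⟩ <;> by_contra hcon
  · have := h1.1 (by omega)
    omega
  · have : Sᶜ.card ≤ 2 := by omega
    interval_cases Sᶜ.card <;> omega
  · have : Sᶜ.card ≤ 3 := by omega
    interval_cases Sᶜ.card <;> omega

section Construction

/-- Closed neighborhoods in a graph on eight vertices, as lists. -/
structure IsNbhdList (L : Fin 8 → List (Fin 8)) : Prop where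
  mem_self : ∀ v, v ∈ L v
  symm : ∀ u v, v ∈ L u → u ∈ L v
  nodup : ∀ v, (L v).Nodup

/-- The number of elements of `N[v]` in a set which meets the eight core vertices in `b` and
contains `j` of the further vertices attached to `0` and `1`. -/
def nbhdCount (L : Fin 8 → List (Fin 8)) (b : Fin 8 → Bool) (j : ℕ) (v : Fin 8) : ℕ :=
  (L v).countP b + if v = 0 ∨ v = 1 then j else 0

/-- Every core vertex is dominated. -/
def allCovered (L : Fin 8 → List (Fin 8)) (b : Fin 8 → Bool) (j : ℕ) : Bool :=
  [0, 1, 2, 3, 4, 5, 6, 7].all fun v => Nat.ble 1 (nbhdCount L b j v)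

/-- The number of overdominated core vertices. -/
def overCount (L : Fin 8 → List (Fin 8)) (b : Fin 8 → Bool) (j : ℕ) : ℕ :=
  [0, 1, 2, 3, 4, 5, 6, 7].countP fun v => Nat.ble 2 (nbhdCount L b j v)

/-- The number of chosen core vertices. -/
def coreSize (b : Fin 8 → Bool) : ℕ := [0, 1, 2, 3, 4, 5, 6, 7].countP b

/-- The core graph with `k` vertices adjacent to `0` and `1` and `i` isolated vertices added. -/
def extendedGraph (L : Fin 8 → List (Fin 8)) (k i : ℕ) : SimpleGraph (Fin 8 ⊕ Fin k ⊕ Fin i) :=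
  SimpleGraph.fromRel fun
    | Sum.inl u, Sum.inl v => v ∈ L u
    | Sum.inl u, Sum.inr (Sum.inl _) => u = 0 ∨ u = 1
    | _, _ => False

/-- The set of vertices consisting of the given parts. -/
def partsSet {k i : ℕ} (b : Fin 8 → Bool) (J : Finset (Fin k)) (I : Finset (Fin i)) :
    Set (Fin 8 ⊕ Fin k ⊕ Fin i) :=
  {x | Sum.elim (fun u => b u = true) (Sum.elim (· ∈ J) (· ∈ I)) x}

theorem exists_eq_partsSet {k i : ℕ} (S : Set (Fin 8 ⊕ Fin k ⊕ Fin i)) :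
    ∃ b J I, S = partsSet b J I := by
  classical
  refine ⟨fun u => decide (Sum.inl u ∈ S), Finset.univ.filter fun w => Sum.inr (Sum.inl w) ∈ S,
    Finset.univ.filter fun t => Sum.inr (Sum.inr t) ∈ S, ?_⟩
  ext (u | w | t) <;> simp [partsSet]

theorem ncard_sum_eq {α β : Type*} [Finite α] [Finite β] (T : Set (α ⊕ β)) :
    T.ncard = {a | Sum.inl a ∈ T}.ncard + {b | Sum.inr b ∈ T}.ncard := by
  have h : T = Sum.inl '' {a | Sum.inl a ∈ T} ∪ Sum.inr '' {b | Sum.inr b ∈ T} := by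
    ext (a | b) <;> simp
  conv_lhs => rw [h]
  rw [Set.ncard_union_eq, Set.ncard_image_of_injective _ Sum.inl_injective,
    Set.ncard_image_of_injective _ Sum.inr_injective]
  rw [Set.disjoint_left]
  rintro _ ⟨a, -, rfl⟩ ⟨b, -, hb⟩
  cases hb

theorem ncard_setOf_fin_eight (p : Fin 8 → Bool) :
    {v | p v = true}.ncard = [0, 1, 2, 3, 4, 5, 6, 7].countP p := by
  have h : {v | p v = true} = (Finset.univ.filter fun v => p v = true : Finset (Fin 8)) := by
    ext; simp
  rw [h, Set.ncard_coe_finset, Finset.card_filter, Fin.sum_univ_eight]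
  simp only [List.countP_cons, List.countP_nil]
  omega

theorem ncard_setOf_eq_and {α : Type*} (a : α) (p : Prop) [Decidable p] :
    {x | x = a ∧ p}.ncard = if p then 1 else 0 := by
  split_ifs with h <;> simp [h]

variable {L : Fin 8 → List (Fin 8)} {k i : ℕ}

theorem ncard_setOf_mem_eq_countP (hL : IsNbhdList L) (b : Fin 8 → Bool) (v : Fin 8) :
    {u | u ∈ L v ∧ b u = true}.ncard = (L v).countP b := by
  rw [List.countP_eq_length_filter,
    ← List.toFinset_card_of_nodup ((hL.nodup v).filter _), ← Set.ncard_coe_finset]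
  congr 1
  ext u
  simp

theorem ncard_closedNbhd_core (hL : IsNbhdList L) (b : Fin 8 → Bool) (J : Finset (Fin k))
    (I : Finset (Fin i)) (v : Fin 8) :
    (closedNbhd (extendedGraph L k i) (Sum.inl v) ∩ partsSet b J I).ncard =
      nbhdCount L b J.card v := by
  have h1 : ∀ u, Sum.inl u ∈ closedNbhd (extendedGraph L k i) (Sum.inl v) ∩ partsSet b J I ↔
      u ∈ L v ∧ b u = true := by
    intro u
    have := hL.mem_self
    have := hL.symm
    simp [closedNbhd, extendedGraph, partsSet]
    grind
  have h2 : ∀ w, Sum.inr (Sum.inl w) ∈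
      closedNbhd (extendedGraph L k i) (Sum.inl v) ∩ partsSet b J I ↔
      (v = 0 ∨ v = 1) ∧ w ∈ J := by
    simp [closedNbhd, extendedGraph, partsSet]
  have h3 : ∀ t, Sum.inr (Sum.inr t) ∉
      closedNbhd (extendedGraph L k i) (Sum.inl v) ∩ partsSet b J I := by
    simp [closedNbhd, extendedGraph]
  rw [ncard_sum_eq, ncard_sum_eq]
  simp only [Set.mem_ofPred_eq, h1, h2, h3]
  rw [nbhdCount, ncard_setOf_mem_eq_countP hL]
  split_ifs with h <;> simp [h]

theorem ncard_closedNbhd_twin (b : Fin 8 → Bool) (J : Finset (Fin k)) (I : Finset (Fin i))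
    (w : Fin k) :
    (closedNbhd (extendedGraph L k i) (Sum.inr (Sum.inl w)) ∩ partsSet b J I).ncard =
      (b 0).toNat + (b 1).toNat + if w ∈ J then 1 else 0 := by
  have h1 : ∀ u, Sum.inl u ∈
      closedNbhd (extendedGraph L k i) (Sum.inr (Sum.inl w)) ∩ partsSet b J I ↔
      (decide (u = 0 ∨ u = 1) && b u) = true := by
    simp [closedNbhd, extendedGraph, partsSet]
  have h2 : ∀ w', Sum.inr (Sum.inl w') ∈
      closedNbhd (extendedGraph L k i) (Sum.inr (Sum.inl w)) ∩ partsSet b J I ↔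
      w' = w ∧ w ∈ J := by
    simp [closedNbhd, extendedGraph, partsSet]
  have h3 : ∀ t, Sum.inr (Sum.inr t) ∉
      closedNbhd (extendedGraph L k i) (Sum.inr (Sum.inl w)) ∩ partsSet b J I := by
    simp [closedNbhd, extendedGraph]
  rw [ncard_sum_eq, ncard_sum_eq]
  simp only [Set.mem_ofPred_eq, h1, h2, h3]
  rw [ncard_setOf_fin_eight fun u => decide (u = 0 ∨ u = 1) && b u, ncard_setOf_eq_and]
  cases h0 : b 0 <;> cases h1 : b 1 <;> simp [h0, h1]

theorem ncard_closedNbhd_isolated (b : Fin 8 → Bool) (J : Finset (Fin k)) (I : Finset (Fin i))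
    (t : Fin i) :
    (closedNbhd (extendedGraph L k i) (Sum.inr (Sum.inr t)) ∩ partsSet b J I).ncard =
      if t ∈ I then 1 else 0 := by
  have h : closedNbhd (extendedGraph L k i) (Sum.inr (Sum.inr t)) = {Sum.inr (Sum.inr t)} := by
    ext (u | w | t') <;> simp [closedNbhd, extendedGraph]
  rw [h]
  split_ifs with ht
  · rw [Set.inter_eq_left.2 (by simpa [partsSet] using ht), Set.ncard_singleton]
  · rw [Set.singleton_inter_eq_empty.2 (by simpa [partsSet] using ht), Set.ncard_empty]

theorem isDomSet_iff_ncard {V : Type*} [Finite V] (G : SimpleGraph V) (S : Set V) :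
    IsDomSet G S ↔ ∀ v, 1 ≤ (closedNbhd G v ∩ S).ncard := by
  refine forall_congr' fun v => ?_
  rw [Nat.one_le_iff_ne_zero, ← Nat.pos_iff_ne_zero, Set.ncard_pos]
  refine exists_congr fun s => ?_
  simp only [closedNbhd, Set.mem_inter_iff, Set.mem_insert_iff, SimpleGraph.mem_neighborSet,
    G.adj_comm s v, eq_comm (a := v)]
  tauto

theorem isDomSet_partsSet (hL : IsNbhdList L) (b : Fin 8 → Bool) (J : Finset (Fin k))
    (I : Finset (Fin i)) :
    IsDomSet (extendedGraph L k i) (partsSet b J I) ↔ allCovered L b J.card = true ∧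
      (∀ w, b 0 = true ∨ b 1 = true ∨ w ∈ J) ∧ ∀ t, t ∈ I := by
  rw [isDomSet_iff_ncard]
  simp only [Sum.forall, ncard_closedNbhd_core hL, ncard_closedNbhd_twin,
    ncard_closedNbhd_isolated]
  refine and_congr ?_ (and_congr (forall_congr' fun w => ?_) (forall_congr' fun t => ?_))
  · simp [allCovered, Fin.forall_fin_succ]
  · cases b 0 <;> cases b 1 <;> by_cases h : w ∈ J <;> simp [h]
  · by_cases h : t ∈ I <;> simp [h]

theorem crOf_partsSet (hL : IsNbhdList L) (b : Fin 8 → Bool) (J : Finset (Fin k))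
    (I : Finset (Fin i)) :
    crOf (extendedGraph L k i) (partsSet b J I) = overCount L b J.card +
      bif b 0 && b 1 then k else bif b 0 || b 1 then J.card else 0 := by
  rw [crOf, ncard_sum_eq, ncard_sum_eq]
  simp only [Set.mem_ofPred_eq, ncard_closedNbhd_core hL, ncard_closedNbhd_twin,
    ncard_closedNbhd_isolated]
  have h0 : ∀ t, ¬ 2 ≤ if t ∈ I then 1 else 0 := by
    intro t
    split_ifs <;> omega
  have h1 : ∀ w, (2 ≤ 1 + if w ∈ J then 1 else 0) ↔ w ∈ J := by
    intro w
    split_ifs <;> simp_all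
  have h2 : ∀ w, ¬ 2 ≤ if w ∈ J then 1 else 0 := by
    intro w
    split_ifs <;> omega
  congr 1
  · simpa [overCount] using ncard_setOf_fin_eight fun v => Nat.ble 2 (nbhdCount L b J.card v)
  · simp only [h0]
    cases b 0 <;> cases b 1 <;> simp [h1, h2]

theorem ncard_partsSet (b : Fin 8 → Bool) (J : Finset (Fin k)) (I : Finset (Fin i)) :
    (partsSet b J I).ncard = coreSize b + (J.card + I.card) := by
  rw [ncard_sum_eq, ncard_sum_eq, coreSize, ← ncard_setOf_fin_eight]
  simp [partsSet]

theorem crNum_gammaCR_extendedGraph (hL : IsNbhdList L) {r : ℕ}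
    (hlow : ∀ b j, j ≤ k → allCovered L b j = true → (b 0 = true ∨ b 1 = true ∨ j = k) →
      2 ≤ overCount L b j + (bif b 0 && b 1 then k else bif b 0 || b 1 then j else 0) ∧
      (overCount L b j + (bif b 0 && b 1 then k else bif b 0 || b 1 then j else 0) ≤ 2 →
        8 + k ≤ coreSize b + j + r))
    {b₀ : Fin 8 → Bool} (h0 : b₀ 0 = false) (h1 : b₀ 1 = false)
    (hcov : allCovered L b₀ k = true) (hover : overCount L b₀ k = 2)
    (hsize : coreSize b₀ + r = 8) :
    crNum (extendedGraph L k i) = 2 ∧ gammaCR (extendedGraph L k i) + r = 8 + k + i := by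
  have hlow' : ∀ S, IsDomSet (extendedGraph L k i) S → 2 ≤ crOf (extendedGraph L k i) S ∧
      (crOf (extendedGraph L k i) S = 2 → 8 + k + i ≤ S.ncard + r) := by
    intro S hS
    obtain ⟨b, J, I, rfl⟩ := exists_eq_partsSet S
    obtain ⟨hc, hJ, hI⟩ := (isDomSet_partsSet hL b J I).1 hS
    have hJk : J.card ≤ k := by simpa using J.card_le_univ
    have hIi : I.card = i := by
      rw [Finset.eq_univ_iff_forall.2 hI, Finset.card_univ, Fintype.card_fin]
    have hor : b 0 = true ∨ b 1 = true ∨ J.card = k := by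
      by_contra! hne
      have hJu : J = Finset.univ := Finset.eq_univ_iff_forall.2 fun w =>
        ((hJ w).resolve_left hne.1).resolve_left hne.2.1
      exact hne.2.2 (by rw [hJu, Finset.card_univ, Fintype.card_fin])
    rw [crOf_partsSet hL, ncard_partsSet]
    have := hlow b J.card hJk hc hor
    omega
  have hS₀ : IsDomSet (extendedGraph L k i) (partsSet b₀ Finset.univ Finset.univ) := by
    rw [isDomSet_partsSet hL]
    simpa using hcov
  have hcr₀ : crOf (extendedGraph L k i) (partsSet b₀ Finset.univ Finset.univ) = 2 := by
    rw [crOf_partsSet hL]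
    simpa [h0, h1] using hover
  have hcr : crNum (extendedGraph L k i) = 2 := by
    refine le_antisymm (Nat.sInf_le ⟨_, hS₀, hcr₀⟩) (le_csInf ⟨2, _, hS₀, hcr₀⟩ ?_)
    rintro _ ⟨S, hS, rfl⟩
    exact (hlow' S hS).1
  have hcard : (partsSet b₀ (Finset.univ : Finset (Fin k)) (Finset.univ : Finset (Fin i))).ncard
      + r = 8 + k + i := by
    rw [ncard_partsSet]
    simp only [Finset.card_univ, Fintype.card_fin]
    omega
  have hle : gammaCR (extendedGraph L k i) ≤ _ := Nat.sInf_le ⟨_, hS₀, hcr₀.trans hcr.symm, rfl⟩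
  obtain ⟨S, hS, hS2, hS3⟩ : gammaCR (extendedGraph L k i) ∈
      {r : ℕ | ∃ S, IsDomSet (extendedGraph L k i) S ∧
        crOf (extendedGraph L k i) S = crNum (extendedGraph L k i) ∧ S.ncard = r} :=
    Nat.sInf_mem ⟨_, _, hS₀, hcr₀.trans hcr.symm, rfl⟩
  have := (hlow' S hS).2 (hS2.trans hcr)
  exact ⟨hcr, by omega⟩

theorem two_mul_ncard_edgeSet {V : Type*} [Fintype V] (G : SimpleGraph V) :
    2 * G.edgeSet.ncard + Fintype.card V = ∑ v, (closedNbhd G v).ncard := by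
  classical
  have h : ∀ v, (closedNbhd G v).ncard = G.degree v + 1 := by
    intro v
    rw [closedNbhd, Set.ncard_insert_of_notMem (by simp), Set.ncard_eq_toFinset_card']
    rfl
  rw [Finset.sum_congr rfl fun v _ => h v, Finset.sum_add_distrib,
    G.sum_degrees_eq_twice_card_edges, ← SimpleGraph.coe_edgeFinset, Set.ncard_coe_finset]
  simp

theorem ncard_edgeSet_extendedGraph (hL : IsNbhdList L) :
    2 * (extendedGraph L k i).edgeSet.ncard + 8 = (∑ v, (L v).length) + 4 * k := by
  have hT : partsSet (fun _ => true) (Finset.univ : Finset (Fin k))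
      (Finset.univ : Finset (Fin i)) = Set.univ := by
    ext (u | w | t) <;> simp [partsSet]
  have h : ∀ x, (closedNbhd (extendedGraph L k i) x).ncard = (closedNbhd (extendedGraph L k i) x ∩
      partsSet (fun _ => true) Finset.univ Finset.univ).ncard := by
    simp [hT]
  have := two_mul_ncard_edgeSet (extendedGraph L k i)
  rw [Finset.sum_congr rfl fun x _ => h x, Fintype.sum_sum_type, Fintype.sum_sum_type] at this
  simp only [ncard_closedNbhd_core hL, ncard_closedNbhd_twin, ncard_closedNbhd_isolated,
    nbhdCount, Finset.sum_add_distrib, Fintype.card_sum, Fintype.card_fin, List.countP_true,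
    Finset.card_univ, Finset.mem_univ, if_true, Finset.sum_const, smul_eq_mul] at this
  have hk : (∑ v : Fin 8, if v = 0 ∨ v = 1 then k else 0) = 2 * k := by
    simp [Fin.sum_univ_eight]
    omega
  simp only [hk, Bool.toNat_true] at this
  omega

end Construction

section Transport

variable {V W : Type*} {G : SimpleGraph V} {H : SimpleGraph W}

theorem image_closedNbhd (f : G ≃g H) (v : V) : f '' closedNbhd G v = closedNbhd H (f v) := by
  ext w
  obtain ⟨u, rfl⟩ := f.surjective w
  simp [closedNbhd, f.map_adj_iff]

theorem isDomSet_image (f : G ≃g H) (S : Set V) : IsDomSet H (f '' S) ↔ IsDomSet G S := by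
  rw [IsDomSet, f.surjective.forall]
  simp [IsDomSet, ← image_closedNbhd]

theorem crOf_image (f : G ≃g H) (S : Set V) : crOf H (f '' S) = crOf G S := by
  have h : ∀ v, (closedNbhd H (f v) ∩ f '' S).ncard = (closedNbhd G v ∩ S).ncard := by
    intro v
    rw [← image_closedNbhd, ← Set.image_inter f.injective,
      Set.ncard_image_of_injective _ f.injective]
  rw [crOf, crOf, ← Set.ncard_image_of_injective _ f.injective]
  congr 1
  ext w
  obtain ⟨u, rfl⟩ := f.surjective w
  simp [h]

theorem exists_set_iff_exists_image (f : G ≃g H) (p : Set W → Prop) :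
    (∃ S, p S) ↔ ∃ S : Set V, p (f '' S) :=
  (Set.image_surjective.2 f.surjective).exists

theorem crNum_congr (f : G ≃g H) : crNum H = crNum G := by
  simp only [crNum, exists_set_iff_exists_image f, isDomSet_image, crOf_image]

theorem gammaCR_congr (f : G ≃g H) : gammaCR H = gammaCR G := by
  simp only [gammaCR, exists_set_iff_exists_image f, isDomSet_image, crOf_image, crNum_congr f,
    Set.ncard_image_of_injective _ f.injective]

theorem ncard_edgeSet_congr (f : G ≃g H) : H.edgeSet.ncard = G.edgeSet.ncard :=
  (Nat.card_congr f.mapEdgeSet).symm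

theorem exists_graph_fin [Fintype V] (G : SimpleGraph V) {n : ℕ} (hn : Fintype.card V = n) :
    ∃ H : SimpleGraph (Fin n), H.edgeSet.ncard = G.edgeSet.ncard ∧ crNum H = crNum G ∧
      gammaCR H = gammaCR G := by
  let f := SimpleGraph.Iso.map (Fintype.equivFinOfCardEq hn) G
  exact ⟨_, ncard_edgeSet_congr f, crNum_congr f, gammaCR_congr f⟩

end Transport

section Certificates

/-- The set of core vertices encoded by the bits of `c`. -/
def bitSet (c : ℕ) (v : Fin 8) : Bool := c.testBit v

theorem eq_bitSet (b : Fin 8 → Bool) : ∃ c < 256, b = bitSet c := by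
  refine ⟨Nat.ofBits b, Nat.ofBits_lt_two_pow b, ?_⟩
  ext v
  simp [bitSet]

/-- If the given core vertices dominate the core, then they overdominate at least two vertices,
and if they overdominate exactly two, then they miss at most `r` core vertices. -/
def lowerCheck (L : Fin 8 → List (Fin 8)) (r : ℕ) (b : Fin 8 → Bool) : Bool :=
  !allCovered L b 0 || (Nat.ble 2 (overCount L b 0) &&
    (Nat.ble 3 (overCount L b 0) || Nat.ble 8 (coreSize b + r)))

/-- The analogue of `lowerCheck` with `j` of the further vertices attached to `0` and `1`. -/
def twinCheck (L : Fin 8 → List (Fin 8)) (r : ℕ) (b : Fin 8 → Bool) (j : ℕ) : Bool :=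
  !allCovered L b j || bif b 0 && b 1 then Nat.ble 2 (overCount L b j) else
    bif b 0 || b 1 then Nat.ble 3 (overCount L b j + j) else
      Nat.ble 2 (overCount L b j) && (Nat.ble 3 (overCount L b j) || Nat.ble 8 (coreSize b + r))

/-- The core vertices `b` avoid `0` and `1`, miss `r` core vertices, and together with `j` vertices
attached to `0` and `1` they dominate the core and overdominate two vertices. -/
def witnessCheck (L : Fin 8 → List (Fin 8)) (r : ℕ) (b : Fin 8 → Bool) (j : ℕ) : Bool :=
  allCovered L b j && Nat.beq (overCount L b j) 2 && Nat.beq (coreSize b + r) 8 &&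
    !b 0 && !b 1

theorem nbhdCount_min_two (L : Fin 8 → List (Fin 8)) (b : Fin 8 → Bool) (j : ℕ) (v : Fin 8) :
    min (nbhdCount L b (min j 2) v) 2 = min (nbhdCount L b j v) 2 := by
  unfold nbhdCount
  split_ifs <;> omega

theorem allCovered_min_two (L : Fin 8 → List (Fin 8)) (b : Fin 8 → Bool) (j : ℕ) :
    allCovered L b (min j 2) = allCovered L b j := by
  unfold allCovered
  congr 1
  ext v
  rw [Bool.eq_iff_iff, Nat.ble_eq, Nat.ble_eq]
  have := nbhdCount_min_two L b j v
  omega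

theorem overCount_min_two (L : Fin 8 → List (Fin 8)) (b : Fin 8 → Bool) (j : ℕ) :
    overCount L b (min j 2) = overCount L b j := by
  unfold overCount
  congr 1
  ext v
  rw [Bool.eq_iff_iff, Nat.ble_eq, Nat.ble_eq]
  have := nbhdCount_min_two L b j v
  omega

variable {L : Fin 8 → List (Fin 8)} {r c e n : ℕ}

theorem exists_graph_of_lowerCheck (hL : IsNbhdList L) (he : ∑ v, (L v).length = 2 * e + 8)
    (hlow : (List.range 256).all fun c => lowerCheck L r (bitSet c))
    (hwit : witnessCheck L r (bitSet c) 0) (hn : 8 ≤ n) :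
    ∃ G : SimpleGraph (Fin n), G.edgeSet.ncard = e ∧ crNum G = 2 ∧ gammaCR G = n - r := by
  obtain ⟨i, rfl⟩ := Nat.exists_eq_add_of_le hn
  simp only [witnessCheck, Bool.and_eq_true, Bool.not_eq_true', Nat.beq_eq] at hwit
  obtain ⟨⟨⟨⟨hcov, hover⟩, hsize⟩, h0⟩, h1⟩ := hwit
  have key := crNum_gammaCR_extendedGraph (k := 0) (i := i) hL (r := r) ?_ h0 h1 hcov hover hsize
  · obtain ⟨G, hG, hcr, hγ⟩ := exists_graph_fin (extendedGraph L 0 i) (n := 8 + i) (by simp)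
    have := ncard_edgeSet_extendedGraph (k := 0) (i := i) hL
    exact ⟨G, by omega, by omega, by omega⟩
  · intro b j hj hc _
    obtain ⟨c, hc256, rfl⟩ := eq_bitSet b
    obtain rfl : j = 0 := by omega
    have := List.all_eq_true.1 hlow c (List.mem_range.2 hc256)
    simp only [lowerCheck, hc, Bool.not_true, Bool.false_or, Bool.and_eq_true, Bool.or_eq_true,
      Nat.ble_eq] at this
    simp only [Bool.cond_self]
    omega

theorem exists_graph_of_twinCheck (hL : IsNbhdList L) (he : ∑ v, (L v).length = 2 * e + 8)
    (hlow : (List.range 256).all fun c => [0, 1, 2].all fun j => twinCheck L r (bitSet c) j)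
    (hwit : witnessCheck L r (bitSet c) 1) (hwit' : witnessCheck L r (bitSet c) 2)
    {k : ℕ} (hk : 1 ≤ k) (hn : 8 + k ≤ n) :
    ∃ G : SimpleGraph (Fin n), G.edgeSet.ncard = e + 2 * k ∧ crNum G = 2 ∧
      gammaCR G = n - r := by
  obtain ⟨i, rfl⟩ := Nat.exists_eq_add_of_le hn
  have hw : witnessCheck L r (bitSet c) (min k 2) := by
    obtain rfl | hk2 := hk.eq_or_lt
    · exact hwit
    · rwa [min_eq_right (by omega)]
  simp only [witnessCheck, Bool.and_eq_true, Bool.not_eq_true', Nat.beq_eq,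
    allCovered_min_two, overCount_min_two] at hw
  obtain ⟨⟨⟨⟨hcov, hover⟩, hsize⟩, h0⟩, h1⟩ := hw
  have key := crNum_gammaCR_extendedGraph (k := k) (i := i) hL (r := r) ?_ h0 h1 hcov hover hsize
  · obtain ⟨G, hG, hcr, hγ⟩ := exists_graph_fin (extendedGraph L k i) (n := 8 + k + i)
      (by simp [add_assoc])
    have := ncard_edgeSet_extendedGraph (k := k) (i := i) hL
    exact ⟨G, by omega, by omega, by omega⟩
  · intro b j hj hc hor
    obtain ⟨c, hc256, rfl⟩ := eq_bitSet b
    have h2 : min j 2 ∈ [0, 1, 2] := by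
      simp only [List.mem_cons, List.not_mem_nil]
      omega
    have := List.all_eq_true.1 (List.all_eq_true.1 hlow c (List.mem_range.2 hc256)) _ h2
    simp only [twinCheck, allCovered_min_two, overCount_min_two, hc, Bool.not_true,
      Bool.false_or] at this
    cases h0 : bitSet c 0 <;> cases h1 : bitSet c 1 <;> simp [h0, h1] at this hor ⊢ <;> omega

end Certificates

section Cores

/-- For `4 ≤ e ≤ 14`, the closed neighborhoods of a graph on eight vertices with `e` edges which,
after adding isolated vertices, attains the maximum of `γ_CR`. -/
def coreNbhds : ℕ → Fin 8 → List (Fin 8)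
  | 4 => ![[0, 6, 7], [1, 6, 7], [2], [3], [4], [5], [0, 1, 6], [0, 1, 7]]
  | 5 => ![[0, 1, 2], [0, 1, 3], [0, 2, 3], [1, 2, 3], [4, 5], [4, 5], [6], [7]]
  | 6 => ![[0, 1, 2, 3], [0, 1, 4], [0, 2, 4], [0, 3, 4], [1, 2, 3, 4], [5], [6], [7]]
  | 7 => ![[0, 1, 2, 3], [0, 1, 2, 3], [0, 1, 2, 4], [0, 1, 3, 4], [2, 3, 4], [5], [6], [7]]
  | 8 => ![[0, 2, 3, 6, 7], [1, 6, 7], [0, 2, 4], [0, 3, 4], [2, 3, 4], [5], [0, 1, 6], [0, 1, 7]]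
  | 9 => ![[0, 2, 6, 7], [1, 2, 6, 7], [0, 1, 2, 3, 4], [2, 3, 5], [2, 4], [3, 5], [0, 1, 6],
      [0, 1, 7]]
  | 10 => ![[0, 2, 3, 6, 7], [1, 2, 3, 6, 7], [0, 1, 2, 3, 4], [0, 1, 2, 3], [2, 4], [5],
      [0, 1, 6], [0, 1, 7]]
  | 11 => ![[0, 1, 2, 3, 6, 7], [0, 1, 2, 4, 6, 7], [0, 1, 2, 5], [0, 3, 4], [1, 3, 4], [2, 5],
      [0, 1, 6], [0, 1, 7]]
  | 12 => ![[0, 1, 2, 3, 6, 7], [0, 1, 2, 4, 6, 7], [0, 1, 2, 3, 4], [0, 2, 3, 4], [1, 2, 3, 4],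
      [5], [0, 1, 6], [0, 1, 7]]
  | 13 => ![[0, 1, 2, 3, 4, 6, 7], [0, 1, 2, 5, 6, 7], [0, 1, 2, 3, 5], [0, 2, 3, 5], [0, 4],
      [1, 2, 3, 5], [0, 1, 6], [0, 1, 7]]
  | 14 => ![[0, 1, 2, 3, 4, 6, 7], [0, 1, 2, 3, 5, 6, 7], [0, 1, 2, 4, 5], [0, 1, 3],
      [0, 2, 4, 5], [1, 2, 4, 5], [0, 1, 6], [0, 1, 7]]
  | _ => fun v => [v]

/-- The encoding of the part in the core of an optimal dominating set. -/
def coreWitness : ℕ → ℕ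
  | 4 => 252
  | 5 => 236
  | 6 | 7 => 248
  | 8 | 9 | 11 | 12 | 13 => 240
  | 10 => 228
  | 14 => 232
  | _ => 0

theorem isNbhdList_coreNbhds {e : ℕ} (h4 : 4 ≤ e) (h14 : e ≤ 14) : IsNbhdList (coreNbhds e) := by
  interval_cases e <;> exact ⟨by decide +kernel, by decide +kernel, by decide +kernel⟩

theorem sum_length_coreNbhds {e : ℕ} (h4 : 4 ≤ e) (h14 : e ≤ 14) :
    ∑ v, (coreNbhds e v).length = 2 * e + 8 := by
  interval_cases e <;> decide +kernel

theorem exists_graph_four {n : ℕ} (hn : 8 ≤ n) :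
    ∃ G : SimpleGraph (Fin n), G.edgeSet.ncard = 4 ∧ crNum G = 2 ∧ gammaCR G = n - 2 :=
  exists_graph_of_lowerCheck (c := coreWitness 4) (isNbhdList_coreNbhds le_rfl (by norm_num))
    (sum_length_coreNbhds le_rfl (by norm_num)) (by decide +kernel) (by decide +kernel) hn

theorem exists_graph_five_to_seven {n e : ℕ} (hn : 8 ≤ n) (h5 : 5 ≤ e) (h7 : e ≤ 7) :
    ∃ G : SimpleGraph (Fin n), G.edgeSet.ncard = e ∧ crNum G = 2 ∧ gammaCR G = n - 3 := by
  refine exists_graph_of_lowerCheck (c := coreWitness e)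
    (isNbhdList_coreNbhds (by omega) (by omega)) (sum_length_coreNbhds (by omega) (by omega))
    ?_ ?_ hn <;> interval_cases e <;> decide +kernel

theorem exists_graph_eight_to_fourteen {n e : ℕ} (hn : 8 ≤ n) (h8 : 8 ≤ e) (h14 : e ≤ 14) :
    ∃ G : SimpleGraph (Fin n), G.edgeSet.ncard = e ∧ crNum G = 2 ∧ gammaCR G = n - 4 := by
  refine exists_graph_of_lowerCheck (c := coreWitness e)
    (isNbhdList_coreNbhds (by omega) (by omega)) (sum_length_coreNbhds (by omega) (by omega))
    ?_ ?_ hn <;> interval_cases e <;> decide +kernel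

theorem exists_graph_add_two_mul {n e k : ℕ} (h13 : 13 ≤ e) (h14 : e ≤ 14) (hk : 1 ≤ k)
    (hn : 8 + k ≤ n) :
    ∃ G : SimpleGraph (Fin n), G.edgeSet.ncard = e + 2 * k ∧ crNum G = 2 ∧
      gammaCR G = n - 4 := by
  refine exists_graph_of_twinCheck (c := coreWitness e)
    (isNbhdList_coreNbhds (by omega) (by omega)) (sum_length_coreNbhds (by omega) (by omega))
    ?_ ?_ ?_ hk hn <;> interval_cases e <;> decide +kernel

theorem exists_graph_of_le {n m : ℕ} (hn : 8 ≤ n) (h8 : 8 ≤ m) (hm : m ≤ 2 * (n - 6) + 10) :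
    ∃ G : SimpleGraph (Fin n), G.edgeSet.ncard = m ∧ crNum G = 2 ∧ gammaCR G = n - 4 := by
  obtain h14 | h14 := le_or_gt m 14
  · exact exists_graph_eight_to_fourteen hn h8 h14
  · obtain ⟨e, k, h13, he14, hk, rfl⟩ : ∃ e k, 13 ≤ e ∧ e ≤ 14 ∧ 1 ≤ k ∧ m = e + 2 * k :=
      ⟨m - 2 * ((m - 13) / 2), (m - 13) / 2, by omega, by omega, by omega, by omega⟩
    exact exists_graph_add_two_mul h13 he14 hk (by omega)

end Cores

theorem D_n_two_m_small (n m : ℕ) (hn : 8 ≤ n) :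
    (m = 4 → IsMaxGamma n m (n - 2)) ∧
    (5 ≤ m → m ≤ 7 → IsMaxGamma n m (n - 3)) ∧
    (8 ≤ m → m ≤ 2 * (n - 6) + 10 → IsMaxGamma n m (n - 4)) := by
  refine ⟨?_, fun h5 h7 => ⟨?_, exists_graph_five_to_seven hn h5 h7⟩,
    fun h8 hm => ⟨?_, exists_graph_of_le hn h8 hm⟩⟩
  · rintro rfl
    refine ⟨?_, exists_graph_four hn⟩
    rintro V _ G rfl hm h
    exact (gammaCR_upper G h).1 hm.ge
  · rintro V _ G rfl rfl h
    exact (gammaCR_upper G h).2.1 h5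
  · rintro V _ G rfl rfl h
    exact (gammaCR_upper G h).2.2 h8
end
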